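/- arXiv:2401.03161 — 3 statements merged into one kernel-verified Lean document; each statement's English description precedes it below -/
import Mathlib

section
/- Corollary 3.2 (L∞ estimates). Let (n, n₊, n₋) be a nonnegative classical solution of the CRTM on [0,∞), let (m, m₊, m₋) be a positive stationary state, and define the relative gaps ω = n/m, ω₊ = n₊/m₊, ω₋ = n₋/m₋. Let Γ > 0 and assume that at time 0 the relative gaps are bounded by Γ: ω(0,y,θ) ≤ Γ for all (y,θ) ∈ [−L,L]×[−π,π], ω₊(0,θ) ≤ Γ for θ ∈ [0,π], and ω₋(0,θ) ≤ Γ for θ ∈ [−π,0]. Then for every t ≥ 0 the same bounds hold: ω(t,y,θ) ≤ Γ, ω₊(t,θ) ≤ Γ, and ω₋(t,θ) ≤ Γ on the respective domains. -/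
open MeasureTheory Real Set

noncomputable section

/-- A classical solution of the confined run-and-tumble model (CRTM) on `[0,∞)`. -/
structure IsCRTMSolution (V L : ℝ)
    (K : ℝ → ℝ → ℝ → ℝ) (Kp : ℝ → ℝ → ℝ) (Km : ℝ → ℝ → ℝ)
    (n : ℝ → ℝ → ℝ → ℝ) (np : ℝ → ℝ → ℝ) (nm : ℝ → ℝ → ℝ) : Prop where
  smooth_n : ContDiff ℝ 1 (fun p : ℝ × ℝ × ℝ => n p.1 p.2.1 p.2.2)
  smooth_np : ContDiff ℝ 1 (fun p : ℝ × ℝ => np p.1 p.2)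
  smooth_nm : ContDiff ℝ 1 (fun p : ℝ × ℝ => nm p.1 p.2)
  interior_eq : ∀ t ≥ (0:ℝ), ∀ y ∈ Ioo (-L) L, ∀ θ ∈ Ioo (-π) π,
    deriv (fun s => n s y θ) t + V * sin θ * deriv (fun z => n t z θ) y
      + (∫ θ' in (-π)..π, K y θ (θ' - θ)) * n t y θ
      = ∫ θ' in (-π)..π, K y θ' (θ - θ') * n t y θ'
  top_eq : ∀ t ≥ (0:ℝ), ∀ θ ∈ Ioo (0:ℝ) π,
    deriv (fun s => np s θ) t + (∫ θ' in (-π)..π, Kp θ (θ' - θ)) * np t θ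
      = (∫ θ' in (0:ℝ)..π, Kp θ' (θ - θ') * np t θ') + V * sin θ * n t L θ
  bot_eq : ∀ t ≥ (0:ℝ), ∀ θ ∈ Ioo (-π) (0:ℝ),
    deriv (fun s => nm s θ) t + (∫ θ' in (-π)..π, Km θ (θ' - θ)) * nm t θ
      = (∫ θ' in (-π)..(0:ℝ), Km θ' (θ - θ') * nm t θ') - V * sin θ * n t (-L) θ
  bc_periodic : ∀ t ≥ (0:ℝ), ∀ y ∈ Icc (-L) L, n t y (-π) = n t y π
  bc_top : ∀ t ≥ (0:ℝ), ∀ θ ∈ Ioo (-π) (0:ℝ),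
    -(V * sin θ * n t L θ) = ∫ θ' in (0:ℝ)..π, Kp θ' (θ - θ') * np t θ'
  bc_bot : ∀ t ≥ (0:ℝ), ∀ θ ∈ Ioo (0:ℝ) π,
    V * sin θ * n t (-L) θ = ∫ θ' in (-π)..(0:ℝ), Km θ' (θ - θ') * nm t θ'

lemma crtm_time (G : Set ℝ) (hG : IsOpen G) (h0 : (0:ℝ) ∈ G)
    (h : ∀ t > 0, (∀ s, 0 ≤ s → s < t → s ∈ G) → t ∈ G) : ∀ t ≥ (0:ℝ), t ∈ G := by
  intro t ht
  by_contra hb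
  have hc : IsCompact (Icc 0 t ∩ Gᶜ) := isCompact_Icc.inter_right hG.isClosed_compl
  obtain ⟨t0, ht0, hl⟩ := hc.exists_isLeast ⟨t, ⟨ht, le_refl t⟩, hb⟩
  have hpos : 0 < t0 := by
    rcases ht0.1.1.lt_or_eq with h1 | h1
    · exact h1
    · exact absurd (h1 ▸ h0) ht0.2
  apply ht0.2
  apply h t0 hpos
  intro s hs hst
  by_contra hsG
  have := hl ⟨⟨hs, hst.le.trans ht0.1.2⟩, hsG⟩
  linarith

lemma crtm_open {X : Type*} [TopologicalSpace X] (C : Set X) (hC : IsCompact C)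
    (f : ℝ × X → ℝ) (hf : Continuous f) : IsOpen {t : ℝ | ∀ x ∈ C, 0 < f (t, x)} := by
  rw [isOpen_iff_mem_nhds]
  intro t ht
  have := hC.eventually_forall_of_forall_eventually (x₀ := t) (P := fun t x => 0 < f (t, x))
    (fun x hx => (hf.tendsto (t, x)).eventually_const_lt (ht x hx))
  exact this

lemma crtm_int {a b : ℝ} (hab : a < b) (k u w : ℝ → ℝ) (hk : Continuous k) (hu : Continuous u)
    (hk0 : ∀ x, 0 ≤ k x) (hup : ∀ x ∈ Icc a b, 0 < u x)
    (hw : 0 < ∫ x in a..b, k x * w x) : 0 < ∫ x in a..b, k x * u x := by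
  apply intervalIntegral.integral_pos hab (hk.mul hu).continuousOn
  · intro x hx
    exact mul_nonneg (hk0 x) (hup x (Ioc_subset_Icc_self hx)).le
  · by_contra hcon
    push Not at hcon
    have : ∫ x in a..b, k x * w x = ∫ x in a..b, (0:ℝ) := by
      apply intervalIntegral.integral_congr
      intro x hx
      rw [uIcc_of_le hab.le] at hx
      have h1 : k x * u x ≤ 0 := hcon x hx
      have h2 : k x = 0 := by
        by_contra h3
        have h4 : 0 < k x := lt_of_le_of_ne (hk0 x) (Ne.symm h3)
        have := mul_pos h4 (hup x hx)
        linarith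
      simp [h2]
    rw [this] at hw
    simp at hw

lemma crtm_nonneg_left (f : ℝ → ℝ) (hf : Continuous f) (t : ℝ) (ht : 0 < t)
    (h : ∀ s, 0 ≤ s → s < t → 0 < f s) : 0 ≤ f t := by
  have h1 : Filter.Tendsto f (nhdsWithin t (Iio t)) (nhds (f t)) :=
    (hf.tendsto t).mono_left nhdsWithin_le_nhds
  apply ge_of_tendsto h1
  filter_upwards [Ioo_mem_nhdsLT ht] with s hs
  exact (h s hs.1.le hs.2).le

/-- minimum from the left: derivative nonpositive -/
lemma crtm_deriv_left (f : ℝ → ℝ) (f' a t : ℝ) (ht : a < t) (hf : HasDerivAt f f' t)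
    (h : ∀ s, a < s → s < t → f t ≤ f s) : f' ≤ 0 := by
  have h1 : Filter.Tendsto (slope f t) (nhdsWithin t (Iio t)) (nhds f') :=
    (hasDerivAt_iff_tendsto_slope.1 hf).mono_left
      (nhdsWithin_mono _ (fun x hx => ne_of_lt hx))
  apply le_of_tendsto h1
  filter_upwards [Ioo_mem_nhdsLT ht] with s hs
  rw [slope_def_field]
  exact div_nonpos_of_nonneg_of_nonpos (by linarith [h s hs.1 hs.2]) (by linarith [hs.2])

lemma crtm_deriv_right (f : ℝ → ℝ) (f' a t : ℝ) (ht : t < a) (hf : HasDerivAt f f' t)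
    (h : ∀ s, t < s → s < a → f t ≤ f s) : 0 ≤ f' := by
  have h1 : Filter.Tendsto (slope f t) (nhdsWithin t (Ioi t)) (nhds f') :=
    (hasDerivAt_iff_tendsto_slope.1 hf).mono_left
      (nhdsWithin_mono _ (fun x hx => ne_of_gt hx))
  apply ge_of_tendsto h1
  filter_upwards [Ioo_mem_nhdsGT ht] with s hs
  rw [slope_def_field]
  exact div_nonneg (by linarith [h s hs.1 hs.2]) (by linarith [hs.1])

section
variable {V L : ℝ} {K : ℝ → ℝ → ℝ → ℝ} {Kp : ℝ → ℝ → ℝ} {Km : ℝ → ℝ → ℝ}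
    {n : ℝ → ℝ → ℝ → ℝ} {np : ℝ → ℝ → ℝ} {nm : ℝ → ℝ → ℝ}

lemma crtm_dt3 (h : ContDiff ℝ 1 (fun p : ℝ × ℝ × ℝ => n p.1 p.2.1 p.2.2)) (t y θ : ℝ) :
    HasDerivAt (fun s => n s y θ)
      (fderiv ℝ (fun p : ℝ × ℝ × ℝ => n p.1 p.2.1 p.2.2) (t, y, θ) (1, 0, 0)) t := by
  have h1 := ((h.differentiable one_ne_zero) (t, y, θ)).hasFDerivAt
  have h2 : HasDerivAt (fun s : ℝ => (s, y, θ)) ((1:ℝ), (0:ℝ), (0:ℝ)) t :=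
    (hasDerivAt_id t).prodMk (hasDerivAt_const t (y, θ))
  exact h1.comp_hasDerivAt t h2

lemma crtm_dy3 (h : ContDiff ℝ 1 (fun p : ℝ × ℝ × ℝ => n p.1 p.2.1 p.2.2)) (t y θ : ℝ) :
    HasDerivAt (fun z => n t z θ)
      (fderiv ℝ (fun p : ℝ × ℝ × ℝ => n p.1 p.2.1 p.2.2) (t, y, θ) (0, 1, 0)) y := by
  have h1 := ((h.differentiable one_ne_zero) (t, y, θ)).hasFDerivAt
  have h2 : HasDerivAt (fun s : ℝ => (t, s, θ)) ((0:ℝ), (1:ℝ), (0:ℝ)) y :=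
    (hasDerivAt_const y t).prodMk ((hasDerivAt_id y).prodMk (hasDerivAt_const y θ))
  exact h1.comp_hasDerivAt y h2

lemma crtm_dt2 (h : ContDiff ℝ 1 (fun p : ℝ × ℝ => np p.1 p.2)) (t θ : ℝ) :
    HasDerivAt (fun s => np s θ)
      (fderiv ℝ (fun p : ℝ × ℝ => np p.1 p.2) (t, θ) (1, 0)) t := by
  have h1 := ((h.differentiable one_ne_zero) (t, θ)).hasFDerivAt
  have h2 : HasDerivAt (fun s : ℝ => (s, θ)) ((1:ℝ), (0:ℝ)) t :=
    (hasDerivAt_id t).prodMk (hasDerivAt_const t θ)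
  exact h1.comp_hasDerivAt t h2

lemma crtm_cl_int (hL : 0 < L) (hKc : Continuous (fun p : ℝ × ℝ × ℝ => K p.1 p.2.1 p.2.2))
    (h : IsCRTMSolution V L K Kp Km n np nm) :
    ∀ t ≥ (0:ℝ), ∀ y ∈ Icc (-L) L, ∀ θ ∈ Icc (-π) π,
    deriv (fun s => n s y θ) t + V * sin θ * deriv (fun z => n t z θ) y
      + (∫ θ' in (-π)..π, K y θ (θ' - θ)) * n t y θ
      = ∫ θ' in (-π)..π, K y θ' (θ - θ') * n t y θ' := by
  intro t ht y hy θ hθ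
  have hn := h.smooth_n.continuous
  have hfd := h.smooth_n.continuous_fderiv one_ne_zero
  have hc1 : Continuous (fun p : ℝ × ℝ => deriv (fun s => n s p.1 p.2) t
      + V * sin p.2 * deriv (fun z => n t z p.2) p.1
      + (∫ θ' in (-π)..π, K p.1 p.2 (θ' - p.2)) * n t p.1 p.2) := by
    simp_rw [(crtm_dt3 h.smooth_n _ _ _).deriv, (crtm_dy3 h.smooth_n _ _ _).deriv]
    have e1 : Continuous (fun p : ℝ × ℝ => ∫ θ' in (-π)..π, K p.1 p.2 (θ' - p.2)) := by
      apply intervalIntegral.continuous_parametric_intervalIntegral_of_continuous'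
      exact hKc.comp (f := fun q : (ℝ × ℝ) × ℝ => (q.1.1, q.1.2, q.2 - q.1.2)) (by fun_prop)
    have e2 : Continuous (fun p : ℝ × ℝ => n t p.1 p.2) :=
      hn.comp (f := fun p : ℝ × ℝ => (t, p.1, p.2)) (by fun_prop)
    have e3 : Continuous (fun p : ℝ × ℝ =>
      fderiv ℝ (fun p : ℝ × ℝ × ℝ => n p.1 p.2.1 p.2.2) (t, p.1, p.2)) :=
      hfd.comp (f := fun p : ℝ × ℝ => (t, p.1, p.2)) (by fun_prop)
    exact ((e3.clm_apply continuous_const).add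
      ((continuous_const.mul (continuous_sin.comp continuous_snd)).mul
        (e3.clm_apply continuous_const))).add (e1.mul e2)
  have hc2 : Continuous (fun p : ℝ × ℝ => ∫ θ' in (-π)..π, K p.1 θ' (p.2 - θ') * n t p.1 θ') := by
    apply intervalIntegral.continuous_parametric_intervalIntegral_of_continuous'
    apply Continuous.mul
    · exact hKc.comp (f := fun q : (ℝ × ℝ) × ℝ => (q.1.1, q.2, q.1.2 - q.2)) (by fun_prop)
    · exact hn.comp (f := fun q : (ℝ × ℝ) × ℝ => (t, q.1.1, q.2)) (by fun_prop)
  have heq : EqOn _ _ (Ioo (-L) L ×ˢ Ioo (-π) π) :=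
    fun p hp => h.interior_eq t ht p.1 hp.1 p.2 hp.2
  have := heq.closure hc1 hc2
  rw [closure_prod_eq, closure_Ioo (by linarith), closure_Ioo (by linarith [pi_pos])] at this
  exact this (x := (y, θ)) ⟨hy, hθ⟩

lemma crtm_cl_top (hKpc : Continuous (fun p : ℝ × ℝ => Kp p.1 p.2))
    (h : IsCRTMSolution V L K Kp Km n np nm) :
    ∀ t ≥ (0:ℝ), ∀ θ ∈ Icc (0:ℝ) π,
    deriv (fun s => np s θ) t + (∫ θ' in (-π)..π, Kp θ (θ' - θ)) * np t θ
      = (∫ θ' in (0:ℝ)..π, Kp θ' (θ - θ') * np t θ') + V * sin θ * n t L θ := by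
  intro t ht θ hθ
  have hn := h.smooth_n.continuous
  have hnp := h.smooth_np.continuous
  have hfd := h.smooth_np.continuous_fderiv one_ne_zero
  have hc1 : Continuous (fun θ : ℝ => deriv (fun s => np s θ) t
      + (∫ θ' in (-π)..π, Kp θ (θ' - θ)) * np t θ) := by
    simp_rw [(crtm_dt2 h.smooth_np _ _).deriv]
    have e1 : Continuous (fun θ : ℝ => ∫ θ' in (-π)..π, Kp θ (θ' - θ)) := by
      apply intervalIntegral.continuous_parametric_intervalIntegral_of_continuous'
      exact hKpc.comp (f := fun q : ℝ × ℝ => (q.1, q.2 - q.1)) (by fun_prop)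
    have e2 : Continuous (fun p : ℝ => np t p) :=
      hnp.comp (f := fun p : ℝ => (t, p)) (by fun_prop)
    have e3 : Continuous (fun p : ℝ => fderiv ℝ (fun p : ℝ × ℝ => np p.1 p.2) (t, p)) :=
      hfd.comp (f := fun p : ℝ => (t, p)) (by fun_prop)
    exact (e3.clm_apply continuous_const).add (e1.mul e2)
  have hc2 : Continuous (fun θ : ℝ => (∫ θ' in (0:ℝ)..π, Kp θ' (θ - θ') * np t θ')
      + V * sin θ * n t L θ) := by
    apply Continuous.add
    · apply intervalIntegral.continuous_parametric_intervalIntegral_of_continuous'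
      apply Continuous.mul
      · exact hKpc.comp (f := fun q : ℝ × ℝ => (q.2, q.1 - q.2)) (by fun_prop)
      · exact hnp.comp (f := fun q : ℝ × ℝ => (t, q.2)) (by fun_prop)
    · exact (continuous_const.mul continuous_sin).mul
        (hn.comp (f := fun q : ℝ => (t, L, q)) (by fun_prop))
  have heq : EqOn _ _ (Ioo 0 π) := fun p hp => h.top_eq t ht p hp
  have := heq.closure hc1 hc2
  rw [closure_Ioo (by linarith [pi_pos])] at this
  exact this hθ

lemma crtm_cl_bot (hKmc : Continuous (fun p : ℝ × ℝ => Km p.1 p.2))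
    (h : IsCRTMSolution V L K Kp Km n np nm) :
    ∀ t ≥ (0:ℝ), ∀ θ ∈ Icc (-π) (0:ℝ),
    deriv (fun s => nm s θ) t + (∫ θ' in (-π)..π, Km θ (θ' - θ)) * nm t θ
      = (∫ θ' in (-π)..(0:ℝ), Km θ' (θ - θ') * nm t θ') - V * sin θ * n t (-L) θ := by
  intro t ht θ hθ
  have hn := h.smooth_n.continuous
  have hnp := h.smooth_nm.continuous
  have hfd := h.smooth_nm.continuous_fderiv one_ne_zero
  have hc1 : Continuous (fun θ : ℝ => deriv (fun s => nm s θ) t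
      + (∫ θ' in (-π)..π, Km θ (θ' - θ)) * nm t θ) := by
    simp_rw [(crtm_dt2 h.smooth_nm _ _).deriv]
    have e1 : Continuous (fun θ : ℝ => ∫ θ' in (-π)..π, Km θ (θ' - θ)) := by
      apply intervalIntegral.continuous_parametric_intervalIntegral_of_continuous'
      exact hKmc.comp (f := fun q : ℝ × ℝ => (q.1, q.2 - q.1)) (by fun_prop)
    have e2 : Continuous (fun p : ℝ => nm t p) :=
      hnp.comp (f := fun p : ℝ => (t, p)) (by fun_prop)
    have e3 : Continuous (fun p : ℝ => fderiv ℝ (fun p : ℝ × ℝ => nm p.1 p.2) (t, p)) :=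
      hfd.comp (f := fun p : ℝ => (t, p)) (by fun_prop)
    exact (e3.clm_apply continuous_const).add (e1.mul e2)
  have hc2 : Continuous (fun θ : ℝ => (∫ θ' in (-π)..(0:ℝ), Km θ' (θ - θ') * nm t θ')
      - V * sin θ * n t (-L) θ) := by
    apply Continuous.sub
    · apply intervalIntegral.continuous_parametric_intervalIntegral_of_continuous'
      apply Continuous.mul
      · exact hKmc.comp (f := fun q : ℝ × ℝ => (q.2, q.1 - q.2)) (by fun_prop)
      · exact hnp.comp (f := fun q : ℝ × ℝ => (t, q.2)) (by fun_prop)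
    · exact (continuous_const.mul continuous_sin).mul
        (hn.comp (f := fun q : ℝ => (t, -L, q)) (by fun_prop))
  have heq : EqOn _ _ (Ioo (-π) 0) := fun p hp => h.bot_eq t ht p hp
  have := heq.closure hc1 hc2
  rw [closure_Ioo (by linarith [pi_pos])] at this
  exact this hθ

end

lemma crtm_int_lin (k u w : ℝ → ℝ) (a b c : ℝ) (hk : Continuous k) (hu : Continuous u)
    (hw : Continuous w) : ∫ x in a..b, k x * (c * u x - w x)
      = c * (∫ x in a..b, k x * u x) - ∫ x in a..b, k x * w x := by
  rw [← intervalIntegral.integral_const_mul, ← intervalIntegral.integral_sub]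
  · congr 1; ext x; ring
  · exact (continuous_const.mul (hk.mul hu)).intervalIntegrable _ _
  · exact (hk.mul hw).intervalIntegrable _ _

lemma crtm_key
    (V L : ℝ) (hV : 0 < V) (hL : 0 < L)
    (K : ℝ → ℝ → ℝ → ℝ) (Kp : ℝ → ℝ → ℝ) (Km : ℝ → ℝ → ℝ)
    (hKc : Continuous (fun p : ℝ × ℝ × ℝ => K p.1 p.2.1 p.2.2))
    (hKpc : Continuous (fun p : ℝ × ℝ => Kp p.1 p.2))
    (hKmc : Continuous (fun p : ℝ × ℝ => Km p.1 p.2))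
    (hKnn : ∀ y θ z, 0 ≤ K y θ z)
    (hKpnn : ∀ θ z, 0 ≤ Kp θ z)
    (hKmnn : ∀ θ z, 0 ≤ Km θ z)
    (n : ℝ → ℝ → ℝ → ℝ) (np : ℝ → ℝ → ℝ) (nm : ℝ → ℝ → ℝ)
    (hsol : IsCRTMSolution V L K Kp Km n np nm)
    (m : ℝ → ℝ → ℝ) (mp : ℝ → ℝ) (mm : ℝ → ℝ)
    (hstat : IsCRTMSolution V L K Kp Km (fun _ => m) (fun _ => mp) (fun _ => mm))
    (hm_pos : ∀ y ∈ Icc (-L) L, ∀ θ ∈ Icc (-π) π, 0 < m y θ)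
    (hmp_pos : ∀ θ ∈ Icc (0:ℝ) π, 0 < mp θ)
    (hmm_pos : ∀ θ ∈ Icc (-π) (0:ℝ), 0 < mm θ)
    (Γ ε : ℝ) (hε : 0 < ε)
    (h0 : ∀ y ∈ Icc (-L) L, ∀ θ ∈ Icc (-π) π, n 0 y θ / m y θ ≤ Γ)
    (h0p : ∀ θ ∈ Icc (0:ℝ) π, np 0 θ / mp θ ≤ Γ)
    (h0m : ∀ θ ∈ Icc (-π) (0:ℝ), nm 0 θ / mm θ ≤ Γ) :
    ∀ t ≥ (0:ℝ),
      (∀ x ∈ Icc (-L) L ×ˢ Icc (-π) π, 0 < (Γ + ε * (1 + t)) * m x.1 x.2 - n t x.1 x.2)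
      ∧ (∀ θ ∈ Icc (0:ℝ) π, 0 < (Γ + ε * (1 + t)) * mp θ - np t θ)
      ∧ (∀ θ ∈ Icc (-π) (0:ℝ), 0 < (Γ + ε * (1 + t)) * mm θ - nm t θ) := by
  have hpi := pi_pos
  have cn : Continuous (fun p : ℝ × ℝ × ℝ => n p.1 p.2.1 p.2.2) := hsol.smooth_n.continuous
  have cnp : Continuous (fun p : ℝ × ℝ => np p.1 p.2) := hsol.smooth_np.continuous
  have cnm : Continuous (fun p : ℝ × ℝ => nm p.1 p.2) := hsol.smooth_nm.continuous
  have cm : Continuous (fun p : ℝ × ℝ => m p.1 p.2) :=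
    hstat.smooth_n.continuous.comp (f := fun p : ℝ × ℝ => ((0:ℝ), p.1, p.2)) (by fun_prop)
  have cmp : Continuous mp :=
    hstat.smooth_np.continuous.comp (f := fun p : ℝ => ((0:ℝ), p)) (by fun_prop)
  have cmm : Continuous mm :=
    hstat.smooth_nm.continuous.comp (f := fun p : ℝ => ((0:ℝ), p)) (by fun_prop)
  have ha : ∀ t, HasDerivAt (fun t => Γ + ε * (1 + t)) ε t := by
    intro t
    have := (((hasDerivAt_id t).const_add 1).const_mul ε).const_add Γ
    simpa using this
  refine crtm_time {t | (∀ x ∈ Icc (-L) L ×ˢ Icc (-π) π,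
        0 < (Γ + ε * (1 + t)) * m x.1 x.2 - n t x.1 x.2)
      ∧ (∀ θ ∈ Icc (0:ℝ) π, 0 < (Γ + ε * (1 + t)) * mp θ - np t θ)
      ∧ (∀ θ ∈ Icc (-π) (0:ℝ), 0 < (Γ + ε * (1 + t)) * mm θ - nm t θ)} ?_ ?_ ?_
  · refine IsOpen.inter ?_ (IsOpen.inter ?_ ?_)
    · exact crtm_open _ (isCompact_Icc.prod isCompact_Icc)
        (fun p : ℝ × ℝ × ℝ => (Γ + ε * (1 + p.1)) * m p.2.1 p.2.2 - n p.1 p.2.1 p.2.2)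
        (Continuous.sub (Continuous.mul (by fun_prop) (cm.comp continuous_snd)) cn)
    · exact crtm_open _ isCompact_Icc
        (fun p : ℝ × ℝ => (Γ + ε * (1 + p.1)) * mp p.2 - np p.1 p.2)
        (Continuous.sub (Continuous.mul (by fun_prop) (cmp.comp continuous_snd)) cnp)
    · exact crtm_open _ isCompact_Icc
        (fun p : ℝ × ℝ => (Γ + ε * (1 + p.1)) * mm p.2 - nm p.1 p.2)
        (Continuous.sub (Continuous.mul (by fun_prop) (cmm.comp continuous_snd)) cnm)
  · refine ⟨?_, ?_, ?_⟩
    · rintro ⟨y, θ⟩ ⟨hy, hθ⟩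
      have h1 := hm_pos y hy θ hθ
      have h2 := (div_le_iff₀ h1).1 (h0 y hy θ hθ)
      have := mul_pos hε h1
      simp only; linarith
    · intro θ hθ
      have h1 := hmp_pos θ hθ
      have h2 := (div_le_iff₀ h1).1 (h0p θ hθ)
      have := mul_pos hε h1
      linarith
    · intro θ hθ
      have h1 := hmm_pos θ hθ
      have h2 := (div_le_iff₀ h1).1 (h0m θ hθ)
      have := mul_pos hε h1
      linarith
  intro t ht hbef
  have ht' : t ≥ 0 := ht.le
  -- nonnegativity at time t
  have nn : ∀ y ∈ Icc (-L) L, ∀ θ ∈ Icc (-π) π, 0 ≤ (Γ + ε * (1 + t)) * m y θ - n t y θ := by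
    intro y hy θ hθ
    refine crtm_nonneg_left (fun t => (Γ + ε * (1 + t)) * m y θ - n t y θ) ?_ t ht
      (fun s hs hst => (hbef s hs hst).1 (y, θ) ⟨hy, hθ⟩)
    exact Continuous.sub (by fun_prop) (cn.comp (f := fun s : ℝ => (s, y, θ)) (by fun_prop))
  have nnp : ∀ θ ∈ Icc (0:ℝ) π, 0 ≤ (Γ + ε * (1 + t)) * mp θ - np t θ := by
    intro θ hθ
    refine crtm_nonneg_left (fun t => (Γ + ε * (1 + t)) * mp θ - np t θ) ?_ t ht
      (fun s hs hst => (hbef s hs hst).2.1 θ hθ)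
    exact Continuous.sub (by fun_prop) (cnp.comp (f := fun s : ℝ => (s, θ)) (by fun_prop))
  have nnm : ∀ θ ∈ Icc (-π) (0:ℝ), 0 ≤ (Γ + ε * (1 + t)) * mm θ - nm t θ := by
    intro θ hθ
    refine crtm_nonneg_left (fun t => (Γ + ε * (1 + t)) * mm θ - nm t θ) ?_ t ht
      (fun s hs hst => (hbef s hs hst).2.2 θ hθ)
    exact Continuous.sub (by fun_prop) (cnm.comp (f := fun s : ℝ => (s, θ)) (by fun_prop))
  set a := Γ + ε * (1 + t) with ha_def
  have cnpt : Continuous (fun θ => np t θ) := cnp.comp (f := fun s : ℝ => (t, s)) (by fun_prop)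
  have cnmt : Continuous (fun θ => nm t θ) := cnm.comp (f := fun s : ℝ => (t, s)) (by fun_prop)
  have cKp : ∀ θ, Continuous (fun θ' => Kp θ' (θ - θ')) := fun θ =>
    hKpc.comp (f := fun s : ℝ => (s, θ - s)) (by fun_prop)
  have cKm : ∀ θ, Continuous (fun θ' => Km θ' (θ - θ')) := fun θ =>
    hKmc.comp (f := fun s : ℝ => (s, θ - s)) (by fun_prop)
  have intp := fun θ => crtm_int_lin (fun θ' => Kp θ' (θ - θ')) mp (fun θ => np t θ) 0 π a
    (cKp θ) cmp cnpt
  have intm := fun θ => crtm_int_lin (fun θ' => Km θ' (θ - θ')) mm (fun θ => nm t θ) (-π) 0 a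
    (cKm θ) cmm cnmt
  have ppos : ∀ θ ∈ Icc (0:ℝ) π, 0 < a * mp θ - np t θ := by
    intro θ hθ
    by_contra hcon
    have hz : a * mp θ - np t θ = 0 := le_antisymm (not_lt.1 hcon) (nnp θ hθ)
    have hd := (crtm_dt2 hsol.smooth_np t θ)
    have e1 := crtm_cl_top hKpc hsol t ht' θ hθ
    have e2 := crtm_cl_top hKpc hstat t ht' θ hθ
    rw [hd.deriv] at e1
    simp only [deriv_const] at e2
    have hle := crtm_deriv_left _ _ 0 t ht (((ha t).mul_const (mp θ)).sub hd) (by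
      intro s hs hst
      have := (hbef s hs.le hst).2.1 θ hθ
      simp only [Pi.sub_apply]
      linarith)
    have hI : 0 ≤ ∫ x in (0:ℝ)..π, Kp x (θ - x) * (a * mp x - np t x) :=
      intervalIntegral.integral_nonneg hpi.le
        (fun x hx => mul_nonneg (hKpnn _ _) (nnp x hx))
    have := intp θ
    have hs0 := sin_nonneg_of_mem_Icc hθ
    have h1 : 0 ≤ V * sin θ * (a * m L θ - n t L θ) := mul_nonneg (mul_nonneg hV.le hs0)
      (nn L ⟨by linarith, le_refl _⟩ θ ⟨by linarith [hθ.1], hθ.2⟩)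
    have h2 := mul_pos hε (hmp_pos θ hθ)
    have h3 : (∫ θ' in (-π)..π, Kp θ (θ' - θ)) * np t θ =
      a * ((∫ θ' in (-π)..π, Kp θ (θ' - θ)) * mp θ) := by
      rw [show np t θ = a * mp θ by linarith]; ring
    have e3 := congrArg (fun z => a * z) e2
    simp only [mul_add, zero_add] at e3
    linarith
  have mpos : ∀ θ ∈ Icc (-π) (0:ℝ), 0 < a * mm θ - nm t θ := by
    intro θ hθ
    by_contra hcon
    have hz : a * mm θ - nm t θ = 0 := le_antisymm (not_lt.1 hcon) (nnm θ hθ)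
    have hd := (crtm_dt2 hsol.smooth_nm t θ)
    have e1 := crtm_cl_bot hKmc hsol t ht' θ hθ
    have e2 := crtm_cl_bot hKmc hstat t ht' θ hθ
    rw [hd.deriv] at e1
    simp only [deriv_const] at e2
    have hle := crtm_deriv_left _ _ 0 t ht (((ha t).mul_const (mm θ)).sub hd) (by
      intro s hs hst
      have := (hbef s hs.le hst).2.2 θ hθ
      simp only [Pi.sub_apply]
      linarith)
    have hI : 0 ≤ ∫ x in (-π)..(0:ℝ), Km x (θ - x) * (a * mm x - nm t x) :=
      intervalIntegral.integral_nonneg (by linarith)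
        (fun x hx => mul_nonneg (hKmnn _ _) (nnm x hx))
    have := intm θ
    have hs0 := sin_nonpos_of_nonpos_of_neg_pi_le hθ.2 hθ.1
    have h1 : 0 ≤ V * (-sin θ) * (a * m (-L) θ - n t (-L) θ) :=
      mul_nonneg (mul_nonneg hV.le (by linarith))
      (nn (-L) ⟨le_refl _, by linarith⟩ θ ⟨hθ.1, by linarith [hθ.2]⟩)
    have h2 := mul_pos hε (hmm_pos θ hθ)
    have h3 : (∫ θ' in (-π)..π, Km θ (θ' - θ)) * nm t θ =
      a * ((∫ θ' in (-π)..π, Km θ (θ' - θ)) * mm θ) := by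
      rw [show nm t θ = a * mm θ by linarith]; ring
    have e3 := congrArg (fun z => a * z) e2
    simp only [mul_sub, zero_add] at e3
    linarith
  refine ⟨?_, ppos, mpos⟩
  rintro ⟨y, θ⟩ ⟨hy, hθ⟩
  simp only at hy hθ ⊢
  by_contra hcon
  have hz : a * m y θ - n t y θ = 0 := le_antisymm (not_lt.1 hcon) (nn y hy θ hθ)
  have hdt := crtm_dt3 hsol.smooth_n t y θ
  have hdy := crtm_dy3 hsol.smooth_n t y θ
  have hdm := crtm_dy3 (n := fun _ => m) hstat.smooth_n t y θ
  have e1 := crtm_cl_int hL hKc hsol t ht' y hy θ hθ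
  have e2 := crtm_cl_int hL hKc hstat t ht' y hy θ hθ
  rw [hdt.deriv, hdy.deriv] at e1
  rw [hdm.deriv] at e2
  simp only [deriv_const] at e2
  have hle := crtm_deriv_left _ _ 0 t ht (((ha t).mul_const (m y θ)).sub hdt) (by
      intro s hs hst
      have := (hbef s hs.le hst).1 (y, θ) ⟨hy, hθ⟩
      simp only [Pi.sub_apply]
      linarith)
  have hI : 0 ≤ ∫ x in (-π)..π, K y x (θ - x) * (a * m y x - n t y x) :=
      intervalIntegral.integral_nonneg (by linarith)
        (fun x hx => mul_nonneg (hKnn _ _ _) (nn y hy x hx))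
  have hlin := crtm_int_lin (fun x => K y x (θ - x)) (fun x => m y x) (fun x => n t y x) (-π) π a
    (hKc.comp (f := fun s : ℝ => (y, s, θ - s)) (by fun_prop))
    (cm.comp (f := fun s : ℝ => (y, s)) (by fun_prop))
    (cn.comp (f := fun s : ℝ => (t, y, s)) (by fun_prop))
  have h2 := mul_pos hε (hm_pos y hy θ hθ)
  have h3 : (∫ θ' in (-π)..π, K y θ (θ' - θ)) * n t y θ =
      a * ((∫ θ' in (-π)..π, K y θ (θ' - θ)) * m y θ) := by
    rw [show n t y θ = a * m y θ by linarith]; ring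
  have e3 := congrArg (fun z => a * z) e2
  simp only [mul_add, zero_add] at e3
  have hdv := (hdm.const_mul a).sub hdy
  generalize fderiv ℝ (fun p : ℝ × ℝ × ℝ => n p.1 p.2.1 p.2.2) (t, y, θ) (0, 1, 0) = ny at *
  generalize fderiv ℝ (fun p : ℝ × ℝ × ℝ => m p.2.1 p.2.2) (t, y, θ) (0, 1, 0) = my at *
  -- the transport term must be positive
  have hA : 0 < V * (sin θ * (a * my - ny)) := by linarith
  have hB : 0 < sin θ * (a * my - ny) := (mul_pos_iff_of_pos_left hV).1 hA
  have hleft : -L < y → a * my - ny ≤ 0 := fun hlt =>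
    crtm_deriv_left _ _ (-L) y hlt hdv (by
      intro s hs hsy
      have := nn s ⟨hs.le, hsy.le.trans hy.2⟩ θ hθ
      simp only [Pi.sub_apply]
      linarith)
  have hright : y < L → 0 ≤ a * my - ny := fun hlt =>
    crtm_deriv_right _ _ L y hlt hdv (by
      intro s hs hsy
      have := nn s ⟨hy.1.trans hs.le, hsy.le⟩ θ hθ
      simp only [Pi.sub_apply]
      linarith)
  rcases hy.1.lt_or_eq with hl | hl
  · have hl1 := hleft hl
    rcases hy.2.lt_or_eq with hr | hr
    · have := hright hr
      rw [le_antisymm hl1 this] at hB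
      simp at hB
    · -- y = L
      have hs : sin θ < 0 := by
        by_contra hs
        have := mul_nonpos_of_nonneg_of_nonpos (not_lt.1 hs) hl1
        linarith
      have hθ2 : θ ∈ Ioo (-π) (0:ℝ) := by
        constructor
        · rcases hθ.1.lt_or_eq with h | h
          · exact h
          · rw [← h] at hs; simp at hs
        · by_contra h
          have := sin_nonneg_of_nonneg_of_le_pi (not_lt.1 h) hθ.2
          linarith
      have b1 := hsol.bc_top t ht' θ hθ2
      have b2 := hstat.bc_top t ht' θ hθ2
      rw [hr] at hz
      have hmL := hm_pos L ⟨by linarith, le_refl _⟩ θ hθ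
      have hw : 0 < ∫ x in (0:ℝ)..π, Kp x (θ - x) * mp x := by
        rw [← b2]
        have := mul_pos (mul_pos hV (neg_pos.2 hs)) hmL
        linarith
      have hu := crtm_int hpi (fun x => Kp x (θ - x)) (fun x => a * mp x - np t x) mp (cKp θ)
        ((continuous_const.mul cmp).sub cnpt) (fun x => hKpnn _ _) ppos hw
      rw [intp θ, ← b1, ← b2] at hu
      have : V * sin θ * (a * m L θ - n t L θ) = 0 := by rw [hz]; ring
      linarith
  · have hr1 := hright (by linarith)
    have hs : 0 < sin θ := by
      by_contra hs
      have := mul_nonpos_of_nonpos_of_nonneg (not_lt.1 hs) hr1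
      linarith
    have hθ2 : θ ∈ Ioo (0:ℝ) π := by
      constructor
      · by_contra h
        have := sin_nonpos_of_nonpos_of_neg_pi_le (not_lt.1 h) hθ.1
        linarith
      · rcases hθ.2.lt_or_eq with h | h
        · exact h
        · rw [h] at hs; simp at hs
    have b1 := hsol.bc_bot t ht' θ hθ2
    have b2 := hstat.bc_bot t ht' θ hθ2
    rw [← hl] at hz
    have hmL := hm_pos (-L) ⟨le_refl _, by linarith⟩ θ hθ
    have hw : 0 < ∫ x in (-π)..(0:ℝ), Km x (θ - x) * mm x := by
      rw [← b2]
      exact mul_pos (mul_pos hV hs) hmL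
    have hu := crtm_int (by linarith) (fun x => Km x (θ - x)) (fun x => a * mm x - nm t x) mm
      (cKm θ) ((continuous_const.mul cmm).sub cnmt) (fun x => hKmnn _ _) mpos hw
    rw [intm θ, ← b1, ← b2] at hu
    have : V * sin θ * (a * m (-L) θ - n t (-L) θ) = 0 := by rw [hz]; ring
    linarith

lemma crtm_lim (Γ t x y : ℝ) (ht : 0 ≤ t) (hx : 0 < x)
    (h : ∀ ε > 0, 0 < (Γ + ε * (1 + t)) * x - y) : y / x ≤ Γ := by
  apply le_of_forall_pos_le_add
  intro δ hδ
  rw [div_le_iff₀ hx]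
  have h1 := h (δ / (1 + t)) (by positivity)
  rw [div_mul_cancel₀ _ (by positivity)] at h1
  linarith

/-- **Corollary 3.2 (L∞ estimates).**  For a nonnegative classical solution of the CRTM
and a positive stationary state, if the relative gaps `ω = n/m`, `ω₊ = n₊/m₊`,
`ω₋ = n₋/m₋` are bounded by `Γ` at time `0`, they stay bounded by `Γ` for all `t ≥ 0`. -/
theorem crtm_Linfty_estimates
    (V L : ℝ) (hV : 0 < V) (hL : 0 < L)
    (K : ℝ → ℝ → ℝ → ℝ) (Kp : ℝ → ℝ → ℝ) (Km : ℝ → ℝ → ℝ)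
    (hKc : Continuous (fun p : ℝ × ℝ × ℝ => K p.1 p.2.1 p.2.2))
    (hKpc : Continuous (fun p : ℝ × ℝ => Kp p.1 p.2))
    (hKmc : Continuous (fun p : ℝ × ℝ => Km p.1 p.2))
    (hKnn : ∀ y θ z, 0 ≤ K y θ z)
    (hKpnn : ∀ θ z, 0 ≤ Kp θ z)
    (hKmnn : ∀ θ z, 0 ≤ Km θ z)
    (n : ℝ → ℝ → ℝ → ℝ) (np : ℝ → ℝ → ℝ) (nm : ℝ → ℝ → ℝ)
    (hsol : IsCRTMSolution V L K Kp Km n np nm)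
    (hn_nn : ∀ t ≥ (0:ℝ), ∀ y ∈ Icc (-L) L, ∀ θ ∈ Icc (-π) π, 0 ≤ n t y θ)
    (hnp_nn : ∀ t ≥ (0:ℝ), ∀ θ ∈ Icc (0:ℝ) π, 0 ≤ np t θ)
    (hnm_nn : ∀ t ≥ (0:ℝ), ∀ θ ∈ Icc (-π) (0:ℝ), 0 ≤ nm t θ)
    (m : ℝ → ℝ → ℝ) (mp : ℝ → ℝ) (mm : ℝ → ℝ)
    (hstat : IsCRTMSolution V L K Kp Km (fun _ => m) (fun _ => mp) (fun _ => mm))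
    (hm_pos : ∀ y ∈ Icc (-L) L, ∀ θ ∈ Icc (-π) π, 0 < m y θ)
    (hmp_pos : ∀ θ ∈ Icc (0:ℝ) π, 0 < mp θ)
    (hmm_pos : ∀ θ ∈ Icc (-π) (0:ℝ), 0 < mm θ)
    (Γ : ℝ) (hΓ : 0 < Γ)
    (h0 : ∀ y ∈ Icc (-L) L, ∀ θ ∈ Icc (-π) π, n 0 y θ / m y θ ≤ Γ)
    (h0p : ∀ θ ∈ Icc (0:ℝ) π, np 0 θ / mp θ ≤ Γ)
    (h0m : ∀ θ ∈ Icc (-π) (0:ℝ), nm 0 θ / mm θ ≤ Γ) :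
    ∀ t ≥ (0:ℝ),
      (∀ y ∈ Icc (-L) L, ∀ θ ∈ Icc (-π) π, n t y θ / m y θ ≤ Γ)
      ∧ (∀ θ ∈ Icc (0:ℝ) π, np t θ / mp θ ≤ Γ)
      ∧ (∀ θ ∈ Icc (-π) (0:ℝ), nm t θ / mm θ ≤ Γ) := by
  intro t ht
  have key := fun ε hε => crtm_key V L hV hL K Kp Km hKc hKpc hKmc hKnn hKpnn hKmnn n np nm hsol
    m mp mm hstat hm_pos hmp_pos hmm_pos Γ ε hε h0 h0p h0m t ht
  refine ⟨fun y hy θ hθ => ?_, fun θ hθ => ?_, fun θ hθ => ?_⟩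
  · exact crtm_lim Γ t _ _ ht (hm_pos y hy θ hθ) (fun ε hε => (key ε hε).1 (y, θ) ⟨hy, hθ⟩)
  · exact crtm_lim Γ t _ _ ht (hmp_pos θ hθ) (fun ε hε => (key ε hε).2.1 θ hθ)
  · exact crtm_lim Γ t _ _ ht (hmm_pos θ hθ) (fun ε hε => (key ε hε).2.2 θ hθ)
end
end

section
/- Decay of the quadratic relative entropy (first step of the proof of Theorem 3.3). Let (n, n₊, n₋) be a nonnegative classical solution of the CRTM on [0,∞), let (m, m₊, m₋) be a positive stationary state, and define the relative gaps ω = n/m, ω₊ = n₊/m₊, ω₋ = n₋/m₋. Define I(t) = ∫_{−L}^{L}∫_{−π}^{π} m(y,θ) ω(t,y,θ)² dθ dy + ∫_0^{π} m₊(θ) ω₊(t,θ)² dθ + ∫_{−π}^{0} m₋(θ) ω₋(t,θ)² dθ. Then: (a) I is nonincreasing on [0,∞), i.e. I(t) ≤ I(s) whenever 0 ≤ s ≤ t; and (b) if the initial relative gaps are bounded by Γ > 0 (ω(0,·,·) ≤ Γ, ω₊(0,·) ≤ Γ, ω₋(0,·) ≤ Γ pointwise), then I(0) ≤ Γ² ·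 ( ∫_{−L}^{L}∫_{−π}^{π} m dθ dy + ∫_0^{π} m₊ dθ + ∫_{−π}^{0} m₋ dθ ) < ∞. -/
open MeasureTheory Real Set

noncomputable section

theorem crtm_swap (f : ℝ → ℝ → ℝ) (hf : Continuous (fun p : ℝ × ℝ => f p.1 p.2)) (a b c d : ℝ) (hab : a ≤ b)
    (hcd : c ≤ d) :
    ∫ x in a..b, ∫ y in c..d, f x y = ∫ y in c..d, ∫ x in a..b, f x y := by
  simp only [intervalIntegral.integral_of_le hab, intervalIntegral.integral_of_le hcd]
  apply MeasureTheory.integral_integral_swap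
  rw [Measure.prod_restrict]
  have h : IntegrableOn (fun p : ℝ × ℝ => f p.1 p.2) (Icc a b ×ˢ Icc c d) (volume.prod volume) :=
    hf.continuousOn.integrableOn_compact (isCompact_Icc.prod isCompact_Icc)
  exact h.mono_set (prod_mono Ioc_subset_Icc_self Ioc_subset_Icc_self)

theorem crtm_param (g g' : ℝ → ℝ → ℝ) (hg : Continuous (fun p : ℝ × ℝ => g p.1 p.2))
    (hg' : Continuous (fun p : ℝ × ℝ => g' p.1 p.2))
    (h : ∀ t x, HasDerivAt (fun s => g s x) (g' t x) t) (a b t : ℝ) :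
    HasDerivAt (fun s => ∫ x in a..b, g s x) (∫ x in a..b, g' t x) t := by
  obtain ⟨C, hC⟩ := ((isCompact_Icc (a := t-1) (b := t+1)).prod
    (isCompact_uIcc (a := a) (b := b))).exists_bound_of_continuousOn hg'.continuousOn
  have c1 : ∀ s, Continuous (g s) := fun s => by fun_prop
  have c2 : ∀ s, Continuous (g' s) := fun s => by fun_prop
  refine (intervalIntegral.hasDerivAt_integral_of_dominated_loc_of_deriv_le (F := g) (F' := g')
    (bound := fun _ => C) (s := Icc (t-1) (t+1)) (Icc_mem_nhds (by linarith) (by linarith))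
    (Filter.Eventually.of_forall fun s => (c1 s).aestronglyMeasurable)
    ((c1 t).intervalIntegrable _ _) (c2 t).aestronglyMeasurable ?_ (by simp) ?_).2
  · refine Filter.Eventually.of_forall fun x hx s hs => ?_
    exact hC (s, x) ⟨hs, uIoc_subset_uIcc hx⟩
  · exact Filter.Eventually.of_forall fun x hx s hs => h s x

theorem crtm_cont {X : Type*} [TopologicalSpace X] [FirstCountableTopology X] (f : X → ℝ → ℝ)
    (hf : Continuous (fun p : X × ℝ => f p.1 p.2)) (a b : ℝ) :
    Continuous fun x => ∫ t in a..b, f x t :=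
  intervalIntegral.continuous_parametric_intervalIntegral_of_continuous' hf a b

/-- gain-loss -/
theorem crtm_coll (A : ℝ → ℝ → ℝ) (u w : ℝ → ℝ) (hA : Continuous (fun p : ℝ × ℝ => A p.1 p.2))
    (hu : Continuous u) (hw : Continuous w) (a b c d : ℝ) (hab : a ≤ b) (hcd : c ≤ d)
    (hpos : ∀ x ∈ Icc a b, ∀ y, 0 ≤ A x y) :
    ∫ y in c..d, ∫ x in a..b, A x y * (2 * w y * u x - w y ^ 2)
      ≤ ∫ x in a..b, ∫ y in c..d, A x y * u x ^ 2 := by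
  rw [crtm_swap (fun x y => A x y * u x ^ 2) (by fun_prop) a b c d hab hcd]
  apply intervalIntegral.integral_mono_on hcd
  · exact (crtm_cont (fun y x => A x y * (2 * w y * u x - w y ^ 2)) (by fun_prop) a b).intervalIntegrable _ _
  · exact (crtm_cont (fun y x => A x y * u x ^ 2) (by fun_prop) a b).intervalIntegrable _ _
  intro y hy
  apply intervalIntegral.integral_mono_on hab
  · exact Continuous.intervalIntegrable (by fun_prop) _ _
  · exact Continuous.intervalIntegrable (by fun_prop) _ _
  intro x hx
  apply mul_le_mul_of_nonneg_left _ (hpos x hx y)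
  nlinarith [sq_nonneg (w y - u x)]

/-- algebra for the gain terms -/
theorem crtm_gain (A : ℝ → ℝ) (u N : ℝ → ℝ) (M : ℝ → ℝ) (w a b : ℝ) (hab : a ≤ b)
    (hA : Continuous A) (hu : Continuous u) (hN : Continuous N) (hM : Continuous M)
    (h : ∀ x ∈ Icc a b, N x = M x * u x) :
    2 * w * (∫ x in a..b, A x * N x) - w ^ 2 * (∫ x in a..b, A x * M x)
      = ∫ x in a..b, (A x * M x) * (2 * w * u x - w ^ 2) := by
  rw [← intervalIntegral.integral_const_mul, ← intervalIntegral.integral_const_mul,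
    ← intervalIntegral.integral_sub (Continuous.intervalIntegrable (by fun_prop) _ _)
      (Continuous.intervalIntegrable (by fun_prop) _ _)]
  apply intervalIntegral.integral_congr
  intro x hx
  rw [uIcc_of_le hab] at hx
  simp only [h x hx]
  ring

theorem crtm_wall (K : ℝ → ℝ → ℝ) (hK : Continuous (fun p : ℝ × ℝ => K p.1 p.2))
    (hKnn : ∀ x z, 0 ≤ K x z) (a b c d : ℝ) (hab : a ≤ b) (hcd : c ≤ d)
    (s N M w np npt mp u kk : ℝ → ℝ) (hs : Continuous s) (hN : Continuous N) (hM : Continuous M)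
    (hw : Continuous w) (hnp : Continuous np) (hnpt : Continuous npt) (hmp : Continuous mp)
    (hu : Continuous u) (hspos : ∀ x ∈ Icc a b, 0 ≤ s x)
    (hMpos : ∀ x ∈ Icc a b, 0 ≤ M x) (hmpos : ∀ x ∈ Icc a b, 0 ≤ mp x)
    (hNM : ∀ x ∈ Icc a b, N x = M x * w x) (hNM' : ∀ x ∈ Icc c d, N x = M x * w x)
    (hnm : ∀ x ∈ Icc a b, np x = mp x * u x)
    (hkk : ∀ x, kk x = (∫ y in a..b, K x (y - x)) + ∫ y in c..d, K x (y - x))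
    (e1 : ∀ x ∈ Ioo a b, npt x + kk x * np x = (∫ y in a..b, K y (x - y) * np y) + s x * N x)
    (e2 : ∀ x ∈ Ioo a b, kk x * mp x = (∫ y in a..b, K y (x - y) * mp y) + s x * M x)
    (e3 : ∀ x ∈ Ioo c d, -(s x * N x) = ∫ y in a..b, K y (x - y) * np y)
    (e4 : ∀ x ∈ Ioo c d, -(s x * M x) = ∫ y in a..b, K y (x - y) * mp y) :
    ∫ x in a..b, 2 * u x * npt x
      ≤ (∫ x in a..b, s x * (M x * w x ^ 2)) + ∫ x in c..d, s x * (M x * w x ^ 2) := by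
  have q1 := crtm_coll (fun x y => K x (y - x) * mp x) u u (by fun_prop) hu hu a b a b hab hab
    (fun x hx y => mul_nonneg (hKnn _ _) (hmpos x hx))
  have q2 := crtm_coll (fun x y => K x (y - x) * mp x) u w (by fun_prop) hu hw a b c d hab hcd
    (fun x hx y => mul_nonneg (hKnn _ _) (hmpos x hx))
  have r1 : Continuous fun y => ∫ x in a..b, K x (y - x) * mp x * (2 * u y * u x - u y ^ 2) :=
    crtm_cont (fun y x => K x (y - x) * mp x * (2 * u y * u x - u y ^ 2)) (by fun_prop) a b
  have r2 : Continuous fun y => ∫ x in a..b, K x (y - x) * mp x * (2 * w y * u x - w y ^ 2) :=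
    crtm_cont (fun y x => K x (y - x) * mp x * (2 * w y * u x - w y ^ 2)) (by fun_prop) a b
  have r3 : Continuous fun x => ∫ y in a..b, K x (y - x) * mp x * u x ^ 2 :=
    crtm_cont (fun x y => K x (y - x) * mp x * u x ^ 2) (by fun_prop) a b
  have r4 : Continuous fun x => ∫ y in c..d, K x (y - x) * mp x * u x ^ 2 :=
    crtm_cont (fun x y => K x (y - x) * mp x * u x ^ 2) (by fun_prop) c d
  have s1 : ∫ x in a..b, 2 * u x * npt x ≤
      ∫ x in a..b, (s x * (M x * w x ^ 2) +
        ((∫ y in a..b, K y (x - y) * mp y * (2 * u x * u y - u x ^ 2))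
        - ((∫ y in a..b, K x (y - x) * mp x * u x ^ 2)
          + ∫ y in c..d, K x (y - x) * mp x * u x ^ 2))) := by
    apply intervalIntegral.integral_mono_on_of_le_Ioo hab
    · exact Continuous.intervalIntegrable (by fun_prop) _ _
    · exact Continuous.intervalIntegrable (by fun_prop) _ _
    intro x hx
    have hx' := Ioo_subset_Icc_self hx
    have g := crtm_gain (fun y => K y (x - y)) u np mp (u x) a b hab (by fun_prop) hu hnp hmp hnm
    rw [← g]
    simp only [mul_assoc (K x _), intervalIntegral.integral_mul_const]
    rw [← add_mul, ← hkk]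
    have E1 := e1 x hx
    have E2 := e2 x hx
    rw [hNM x hx', hnm x hx'] at E1
    have P : 0 ≤ s x * M x * (u x - w x) ^ 2 :=
      mul_nonneg (mul_nonneg (hspos x hx') (hMpos x hx')) (sq_nonneg _)
    have : 2 * u x * npt x = 2 * u x * (∫ y in a..b, K y (x - y) * np y)
      - u x ^ 2 * (∫ y in a..b, K y (x - y) * mp y) - kk x * (mp x * u x ^ 2)
      + s x * M x * (2 * u x * w x - u x ^ 2) := by
      linear_combination 2 * u x * E1 - u x ^ 2 * E2
    rw [this]
    nlinarith [P]
  have s2 : ∫ x in c..d, -(s x * (M x * w x ^ 2)) ≤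
      ∫ x in c..d, ∫ y in a..b, K y (x - y) * mp y * (2 * w x * u y - w x ^ 2) := by
    apply intervalIntegral.integral_mono_on_of_le_Ioo hcd
    · exact Continuous.intervalIntegrable (by fun_prop) _ _
    · exact Continuous.intervalIntegrable (by fun_prop) _ _
    intro x hx
    have hx' := Ioo_subset_Icc_self hx
    have g := crtm_gain (fun y => K y (x - y)) u np mp (w x) a b hab (by fun_prop) hu hnp hmp hnm
    rw [← g, ← e3 x hx, ← e4 x hx, hNM' x hx']
    apply le_of_eq
    ring
  rw [intervalIntegral.integral_add (Continuous.intervalIntegrable (by fun_prop) _ _)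
      (Continuous.intervalIntegrable (by fun_prop) _ _),
    intervalIntegral.integral_sub (Continuous.intervalIntegrable (by fun_prop) _ _)
      (Continuous.intervalIntegrable (by fun_prop) _ _),
    intervalIntegral.integral_add (Continuous.intervalIntegrable (by fun_prop) _ _)
      (Continuous.intervalIntegrable (by fun_prop) _ _)] at s1
  rw [intervalIntegral.integral_neg] at s2
  linarith

theorem crtm_bulk (V L : ℝ) (hL : 0 < L) (K : ℝ → ℝ → ℝ → ℝ)
    (hK : Continuous (fun p : ℝ × ℝ × ℝ => K p.1 p.2.1 p.2.2)) (hKnn : ∀ y θ z, 0 ≤ K y θ z)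
    (N Nt Ny M My W : ℝ → ℝ → ℝ)
    (hN : Continuous (fun p : ℝ × ℝ => N p.1 p.2)) (hNt : Continuous (fun p : ℝ × ℝ => Nt p.1 p.2))
    (hNy : Continuous (fun p : ℝ × ℝ => Ny p.1 p.2)) (hM : Continuous (fun p : ℝ × ℝ => M p.1 p.2))
    (hMy : Continuous (fun p : ℝ × ℝ => My p.1 p.2)) (hW : Continuous (fun p : ℝ × ℝ => W p.1 p.2))
    (hpos : ∀ y ∈ Icc (-L) L, ∀ θ ∈ Icc (-π) π, 0 < M y θ)
    (hNM : ∀ y ∈ Icc (-L) L, ∀ θ ∈ Icc (-π) π, N y θ = M y θ * W y θ)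
    (dN : ∀ y θ, HasDerivAt (fun z => N z θ) (Ny y θ) y)
    (dM : ∀ y θ, HasDerivAt (fun z => M z θ) (My y θ) y)
    (e1 : ∀ y ∈ Ioo (-L) L, ∀ θ ∈ Ioo (-π) π,
      Nt y θ + V * sin θ * Ny y θ + (∫ x in (-π)..π, K y θ (x - θ)) * N y θ
        = ∫ x in (-π)..π, K y x (θ - x) * N y x)
    (e2 : ∀ y ∈ Ioo (-L) L, ∀ θ ∈ Ioo (-π) π,
      V * sin θ * My y θ + (∫ x in (-π)..π, K y θ (x - θ)) * M y θ
        = ∫ x in (-π)..π, K y x (θ - x) * M y x) :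
    ∫ y in (-L)..L, ∫ θ in (-π)..π, 2 * W y θ * Nt y θ
      ≤ -(∫ θ in (-π)..π, V * sin θ * (M L θ * W L θ ^ 2))
        + ∫ θ in (-π)..π, V * sin θ * (M (-L) θ * W (-L) θ ^ 2) := by
  have hπ : -π ≤ π := by linarith [pi_pos]
  have hLL : -L ≤ L := by linarith
  have cs : Continuous fun θ : ℝ => sin θ := continuous_sin
  have cG : Continuous (fun p : ℝ × ℝ =>
      V * sin p.2 * (2 * W p.1 p.2 * Ny p.1 p.2 - W p.1 p.2 ^ 2 * My p.1 p.2)) := by fun_prop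
  have ftc : ∫ y in (-L)..L, ∫ θ in (-π)..π, V * sin θ * (2 * W y θ * Ny y θ - W y θ ^ 2 * My y θ)
      = (∫ θ in (-π)..π, V * sin θ * (M L θ * W L θ ^ 2))
        - ∫ θ in (-π)..π, V * sin θ * (M (-L) θ * W (-L) θ ^ 2) := by
    rw [crtm_swap (fun y θ => V * sin θ * (2 * W y θ * Ny y θ - W y θ ^ 2 * My y θ)) cG _ _ _ _
      hLL hπ, ← intervalIntegral.integral_sub (Continuous.intervalIntegrable (by fun_prop) _ _)
      (Continuous.intervalIntegrable (by fun_prop) _ _)]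
    apply intervalIntegral.integral_congr
    intro θ hθ
    rw [uIcc_of_le hπ] at hθ
    simp only [intervalIntegral.integral_const_mul]
    rw [← mul_sub]
    congr 1
    rw [intervalIntegral.integral_eq_sub_of_hasDerivAt (f := fun y => N y θ ^ 2 / M y θ)]
    · have p1 := hpos L ⟨hLL, le_rfl⟩ θ hθ
      have p2 := hpos (-L) ⟨le_rfl, hLL⟩ θ hθ
      rw [hNM L ⟨hLL, le_rfl⟩ θ hθ, hNM (-L) ⟨le_rfl, hLL⟩ θ hθ]
      field_simp
    · intro y hy
      rw [uIcc_of_le hLL] at hy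
      have p := hpos y hy θ hθ
      refine (((dN y θ).pow 2).div (dM y θ) p.ne').congr_deriv ?_
      simp only [Pi.pow_apply, hNM y hy θ hθ]
      field_simp
      push_cast
      ring
    · exact Continuous.intervalIntegrable (by fun_prop) _ _
  have i1 : Continuous fun y => ∫ θ in (-π)..π, 2 * W y θ * Nt y θ :=
    crtm_cont (fun y θ => 2 * W y θ * Nt y θ) (by fun_prop) _ _
  have i2 : Continuous fun y => ∫ θ in (-π)..π, V * sin θ * (2 * W y θ * Ny y θ - W y θ ^ 2 * My y θ) :=
    crtm_cont (fun y θ => V * sin θ * (2 * W y θ * Ny y θ - W y θ ^ 2 * My y θ)) cG _ _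
  have key : ∫ y in (-L)..L, ∫ θ in (-π)..π, 2 * W y θ * Nt y θ ≤
      ∫ y in (-L)..L, -(∫ θ in (-π)..π, V * sin θ * (2 * W y θ * Ny y θ - W y θ ^ 2 * My y θ)) := by
    apply intervalIntegral.integral_mono_on_of_le_Ioo hLL (i1.intervalIntegrable _ _)
      (i2.neg.intervalIntegrable _ _)
    intro y hy
    simp only [Pi.neg_apply]
    have hy' := Ioo_subset_Icc_self hy
    have c1 : Continuous (W y) := by fun_prop
    have c2 : Continuous (M y) := by fun_prop
    have c3 : Continuous (N y) := by fun_prop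
    have c4 : Continuous (fun p : ℝ × ℝ => K y p.1 p.2) := by fun_prop
    have c5 : Continuous (Nt y) := by fun_prop
    have c6 : Continuous (Ny y) := by fun_prop
    have c7 : Continuous (My y) := by fun_prop
    have q := crtm_coll (fun x θ => K y x (θ - x) * M y x) (W y) (W y) (by fun_prop) c1 c1
      (-π) π (-π) π hπ hπ (fun x hx θ => mul_nonneg (hKnn _ _ _) (hpos y hy' x hx).le)
    have r1 : Continuous fun θ => ∫ x in (-π)..π,
        K y x (θ - x) * M y x * (2 * W y θ * W y x - W y θ ^ 2) :=
      crtm_cont (fun θ x => K y x (θ - x) * M y x * (2 * W y θ * W y x - W y θ ^ 2))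
        (by fun_prop) _ _
    have r2 : Continuous fun θ => ∫ x in (-π)..π, K y θ (x - θ) * M y θ * W y θ ^ 2 :=
      crtm_cont (fun θ x => K y θ (x - θ) * M y θ * W y θ ^ 2) (by fun_prop) _ _
    have s1 : ∫ θ in (-π)..π, 2 * W y θ * Nt y θ ≤ ∫ θ in (-π)..π,
        (((∫ x in (-π)..π, K y x (θ - x) * M y x * (2 * W y θ * W y x - W y θ ^ 2))
          - ∫ x in (-π)..π, K y θ (x - θ) * M y θ * W y θ ^ 2)
          - V * sin θ * (2 * W y θ * Ny y θ - W y θ ^ 2 * My y θ)) := by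
      apply intervalIntegral.integral_mono_on_of_le_Ioo hπ
      · exact Continuous.intervalIntegrable (by fun_prop) _ _
      · exact Continuous.intervalIntegrable (by fun_prop) _ _
      intro θ hθ
      have hθ' := Ioo_subset_Icc_self hθ
      have g := crtm_gain (fun x => K y x (θ - x)) (W y) (N y) (M y) (W y θ) (-π) π hπ
        (by fun_prop) c1 c3 c2 (hNM y hy')
      rw [← g]
      simp only [mul_assoc (K y θ _), intervalIntegral.integral_mul_const]
      have E1 := e1 y hy θ hθ
      have E2 := e2 y hy θ hθ
      rw [hNM y hy' θ hθ'] at E1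
      apply le_of_eq
      linear_combination 2 * W y θ * E1 - W y θ ^ 2 * E2
    rw [intervalIntegral.integral_sub (Continuous.intervalIntegrable (by fun_prop) _ _)
      (Continuous.intervalIntegrable (by fun_prop) _ _),
      intervalIntegral.integral_sub (Continuous.intervalIntegrable (by fun_prop) _ _)
      (Continuous.intervalIntegrable (by fun_prop) _ _)] at s1
    linarith
  rw [intervalIntegral.integral_neg, ftc] at key
  linarith

theorem crtm_clamp_mem (a b x : ℝ) (hab : a ≤ b) : max a (min b x) ∈ Icc a b :=
  ⟨le_max_left _ _, max_le hab (min_le_left _ _)⟩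

theorem crtm_clamp_eq (a b x : ℝ) (hx : x ∈ Icc a b) : max a (min b x) = x := by
  rw [min_eq_right hx.2, max_eq_right hx.1]

theorem crtm_rinv (a b : ℝ) (hab : a ≤ b) (f : ℝ → ℝ) (hf : Continuous f)
    (hpos : ∀ x ∈ Icc a b, 0 < f x) :
    ∃ r : ℝ → ℝ, Continuous r ∧ ∀ x ∈ Icc a b, f x * r x = 1 := by
  refine ⟨fun x => (f (max a (min b x)))⁻¹, ?_, ?_⟩
  · apply Continuous.inv₀ (by fun_prop)
    exact fun x => (hpos _ (crtm_clamp_mem a b x hab)).ne'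
  · intro x hx
    simp only [crtm_clamp_eq a b x hx]
    exact mul_inv_cancel₀ (hpos x hx).ne'

theorem crtm_rinv2 (a b c d : ℝ) (hab : a ≤ b) (hcd : c ≤ d) (f : ℝ → ℝ → ℝ)
    (hf : Continuous (fun p : ℝ × ℝ => f p.1 p.2))
    (hpos : ∀ x ∈ Icc a b, ∀ y ∈ Icc c d, 0 < f x y) :
    ∃ r : ℝ → ℝ → ℝ, Continuous (fun p : ℝ × ℝ => r p.1 p.2) ∧
      ∀ x ∈ Icc a b, ∀ y ∈ Icc c d, f x y * r x y = 1 := by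
  refine ⟨fun x y => (f (max a (min b x)) (max c (min d y)))⁻¹, ?_, ?_⟩
  · apply Continuous.inv₀ (by fun_prop)
    exact fun p => (hpos _ (crtm_clamp_mem a b p.1 hab) _ (crtm_clamp_mem c d p.2 hcd)).ne'
  · intro x hx y hy
    simp only [crtm_clamp_eq a b x hx, crtm_clamp_eq c d y hy]
    exact mul_inv_cancel₀ (hpos x hx y hy).ne'

theorem crtm_alg (m r n : ℝ) (h : m * r = 1) : m * (n / m) ^ 2 = n ^ 2 * r := by
  have hm : m ≠ 0 := left_ne_zero_of_mul_eq_one h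
  have : r = 1 / m := by field_simp; linarith
  rw [this]; field_simp

theorem crtm_bd (m r n Γ : ℝ) (hm : 0 < m) (hn : 0 ≤ n) (h : m * r = 1) (hb : n / m ≤ Γ) :
    n ^ 2 * r ≤ Γ ^ 2 * m := by
  rw [← crtm_alg m r n h, mul_comm]
  exact mul_le_mul_of_nonneg_right (pow_le_pow_left₀ (div_nonneg hn hm.le) hb 2) hm.le

/-- derivative in the first variable -/
theorem crtm_C1 {E : Type*} [NormedAddCommGroup E] [NormedSpace ℝ E] (f : E → ℝ)
    (hf : ContDiff ℝ 1 f) (v : E) : Continuous (fun x => fderiv ℝ f x v) :=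
  (hf.continuous_fderiv (by norm_num)).clm_apply continuous_const

/-- **Decay of the quadratic relative entropy** (first step of the proof of Theorem
3.3).  With `I(t) = ∫∫ m ω² + ∫ m₊ ω₊² + ∫ m₋ ω₋²`:
(a) `I` is nonincreasing on `[0,∞)`;
(b) if the initial relative gaps are bounded by `Γ > 0`, then
`I(0) ≤ Γ² (∫∫ m + ∫ m₊ + ∫ m₋)`. -/
theorem crtm_quadratic_entropy_decay
    (V L : ℝ) (hV : 0 < V) (hL : 0 < L)
    (K : ℝ → ℝ → ℝ → ℝ) (Kp : ℝ → ℝ → ℝ) (Km : ℝ → ℝ → ℝ)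
    (hKc : Continuous (fun p : ℝ × ℝ × ℝ => K p.1 p.2.1 p.2.2))
    (hKpc : Continuous (fun p : ℝ × ℝ => Kp p.1 p.2))
    (hKmc : Continuous (fun p : ℝ × ℝ => Km p.1 p.2))
    (hKnn : ∀ y θ z, 0 ≤ K y θ z)
    (hKpnn : ∀ θ z, 0 ≤ Kp θ z)
    (hKmnn : ∀ θ z, 0 ≤ Km θ z)
    (n : ℝ → ℝ → ℝ → ℝ) (np : ℝ → ℝ → ℝ) (nm : ℝ → ℝ → ℝ)
    (hsol : IsCRTMSolution V L K Kp Km n np nm)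
    (hn_nn : ∀ t ≥ (0:ℝ), ∀ y ∈ Icc (-L) L, ∀ θ ∈ Icc (-π) π, 0 ≤ n t y θ)
    (hnp_nn : ∀ t ≥ (0:ℝ), ∀ θ ∈ Icc (0:ℝ) π, 0 ≤ np t θ)
    (hnm_nn : ∀ t ≥ (0:ℝ), ∀ θ ∈ Icc (-π) (0:ℝ), 0 ≤ nm t θ)
    (m : ℝ → ℝ → ℝ) (mp : ℝ → ℝ) (mm : ℝ → ℝ)
    (hstat : IsCRTMSolution V L K Kp Km (fun _ => m) (fun _ => mp) (fun _ => mm))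
    (hm_pos : ∀ y ∈ Icc (-L) L, ∀ θ ∈ Icc (-π) π, 0 < m y θ)
    (hmp_pos : ∀ θ ∈ Icc (0:ℝ) π, 0 < mp θ)
    (hmm_pos : ∀ θ ∈ Icc (-π) (0:ℝ), 0 < mm θ) :
    -- (a) the quadratic relative entropy is nonincreasing on [0, ∞)
    (∀ s t : ℝ, 0 ≤ s → s ≤ t →
      (∫ y in (-L)..L, ∫ θ in (-π)..π, m y θ * (n t y θ / m y θ) ^ 2)
        + (∫ θ in (0:ℝ)..π, mp θ * (np t θ / mp θ) ^ 2)
        + (∫ θ in (-π)..(0:ℝ), mm θ * (nm t θ / mm θ) ^ 2)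
      ≤ (∫ y in (-L)..L, ∫ θ in (-π)..π, m y θ * (n s y θ / m y θ) ^ 2)
        + (∫ θ in (0:ℝ)..π, mp θ * (np s θ / mp θ) ^ 2)
        + (∫ θ in (-π)..(0:ℝ), mm θ * (nm s θ / mm θ) ^ 2))
    -- (b) the initial bound
    ∧ (∀ Γ : ℝ, 0 < Γ →
        (∀ y ∈ Icc (-L) L, ∀ θ ∈ Icc (-π) π, n 0 y θ / m y θ ≤ Γ) →
        (∀ θ ∈ Icc (0:ℝ) π, np 0 θ / mp θ ≤ Γ) →
        (∀ θ ∈ Icc (-π) (0:ℝ), nm 0 θ / mm θ ≤ Γ) →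
        (∫ y in (-L)..L, ∫ θ in (-π)..π, m y θ * (n 0 y θ / m y θ) ^ 2)
          + (∫ θ in (0:ℝ)..π, mp θ * (np 0 θ / mp θ) ^ 2)
          + (∫ θ in (-π)..(0:ℝ), mm θ * (nm 0 θ / mm θ) ^ 2)
        ≤ Γ ^ 2 * ((∫ y in (-L)..L, ∫ θ in (-π)..π, m y θ)
            + (∫ θ in (0:ℝ)..π, mp θ) + (∫ θ in (-π)..(0:ℝ), mm θ))) := by
  have hπ0 := pi_pos
  have hπ : -π ≤ π := by linarith
  have hπ1 : -π ≤ 0 := by linarith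
  have hLL : -L ≤ L := by linarith
  have cs : Continuous fun θ : ℝ => sin θ := continuous_sin
  have cn := hsol.smooth_n.continuous
  have cnp := hsol.smooth_np.continuous
  have cnm := hsol.smooth_nm.continuous
  have cm : Continuous (fun p : ℝ × ℝ => m p.1 p.2) :=
    hstat.smooth_n.continuous.comp (f := fun p : ℝ × ℝ => ((0:ℝ), p.1, p.2)) (by fun_prop)
  have cmp : Continuous mp :=
    hstat.smooth_np.continuous.comp (f := fun p : ℝ => ((0:ℝ), p)) (by fun_prop)
  have cmm : Continuous mm :=
    hstat.smooth_nm.continuous.comp (f := fun p : ℝ => ((0:ℝ), p)) (by fun_prop)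
  obtain ⟨r, cr, hr⟩ := crtm_rinv2 (-L) L (-π) π hLL hπ m cm hm_pos
  obtain ⟨rp, crp, hrp⟩ := crtm_rinv 0 π hπ0.le mp cmp hmp_pos
  obtain ⟨rm, crm, hrm⟩ := crtm_rinv (-π) 0 hπ1 mm cmm hmm_pos
  -- derivatives
  obtain ⟨nt, cnt, dnt⟩ : ∃ nt : ℝ → ℝ → ℝ → ℝ,
      Continuous (fun p : ℝ × ℝ × ℝ => nt p.1 p.2.1 p.2.2) ∧
      ∀ t y θ, HasDerivAt (fun s => n s y θ) (nt t y θ) t := by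
    refine ⟨fun t y θ => fderiv ℝ (fun p : ℝ × ℝ × ℝ => n p.1 p.2.1 p.2.2) (t, y, θ) (1, 0, 0),
      crtm_C1 _ hsol.smooth_n _, fun t y θ => ?_⟩
    exact (((hsol.smooth_n.differentiable (by norm_num)) (t, y, θ)).hasFDerivAt).comp_hasDerivAt
      (f := fun s : ℝ => (s, y, θ)) t ((hasDerivAt_id t).prodMk (hasDerivAt_const t (y, θ)))
  obtain ⟨ny, cny, dny⟩ : ∃ ny : ℝ → ℝ → ℝ → ℝ,
      Continuous (fun p : ℝ × ℝ × ℝ => ny p.1 p.2.1 p.2.2) ∧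
      ∀ t y θ, HasDerivAt (fun z => n t z θ) (ny t y θ) y := by
    refine ⟨fun t y θ => fderiv ℝ (fun p : ℝ × ℝ × ℝ => n p.1 p.2.1 p.2.2) (t, y, θ) (0, 1, 0),
      crtm_C1 _ hsol.smooth_n _, fun t y θ => ?_⟩
    exact (((hsol.smooth_n.differentiable (by norm_num)) (t, y, θ)).hasFDerivAt).comp_hasDerivAt
      (f := fun z : ℝ => (t, z, θ)) y
      ((hasDerivAt_const y t).prodMk ((hasDerivAt_id y).prodMk (hasDerivAt_const y θ)))
  obtain ⟨my, cmy, dmy⟩ : ∃ my : ℝ → ℝ → ℝ,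
      Continuous (fun p : ℝ × ℝ => my p.1 p.2) ∧
      ∀ y θ, HasDerivAt (fun z => m z θ) (my y θ) y := by
    refine ⟨fun y θ => fderiv ℝ (fun p : ℝ × ℝ × ℝ => m p.2.1 p.2.2) (0, y, θ) (0, 1, 0),
      (crtm_C1 _ hstat.smooth_n _).comp (f := fun p : ℝ × ℝ => ((0:ℝ), p.1, p.2)) (by fun_prop),
      fun y θ => ?_⟩
    exact (((hstat.smooth_n.differentiable (by norm_num)) (0, y, θ)).hasFDerivAt).comp_hasDerivAt
      (f := fun z : ℝ => ((0:ℝ), z, θ)) y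
      ((hasDerivAt_const y (0:ℝ)).prodMk ((hasDerivAt_id y).prodMk (hasDerivAt_const y θ)))
  obtain ⟨npt, cnpt, dnpt⟩ : ∃ nt : ℝ → ℝ → ℝ,
      Continuous (fun p : ℝ × ℝ => nt p.1 p.2) ∧
      ∀ t θ, HasDerivAt (fun s => np s θ) (nt t θ) t := by
    refine ⟨fun t θ => fderiv ℝ (fun p : ℝ × ℝ => np p.1 p.2) (t, θ) (1, 0),
      crtm_C1 _ hsol.smooth_np _, fun t θ => ?_⟩
    exact (((hsol.smooth_np.differentiable (by norm_num)) (t, θ)).hasFDerivAt).comp_hasDerivAt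
      (f := fun s : ℝ => (s, θ)) t ((hasDerivAt_id t).prodMk (hasDerivAt_const t θ))
  obtain ⟨nmt, cnmt, dnmt⟩ : ∃ nt : ℝ → ℝ → ℝ,
      Continuous (fun p : ℝ × ℝ => nt p.1 p.2) ∧
      ∀ t θ, HasDerivAt (fun s => nm s θ) (nt t θ) t := by
    refine ⟨fun t θ => fderiv ℝ (fun p : ℝ × ℝ => nm p.1 p.2) (t, θ) (1, 0),
      crtm_C1 _ hsol.smooth_nm _, fun t θ => ?_⟩
    exact (((hsol.smooth_nm.differentiable (by norm_num)) (t, θ)).hasFDerivAt).comp_hasDerivAt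
      (f := fun s : ℝ => (s, θ)) t ((hasDerivAt_id t).prodMk (hasDerivAt_const t θ))
  -- rewriting of the entropy
  have I1 : ∀ t, (∫ y in (-L)..L, ∫ θ in (-π)..π, m y θ * (n t y θ / m y θ) ^ 2)
      = ∫ y in (-L)..L, ∫ θ in (-π)..π, n t y θ ^ 2 * r y θ := by
    intro t
    apply intervalIntegral.integral_congr
    intro y hy
    apply intervalIntegral.integral_congr
    intro θ hθ
    rw [uIcc_of_le (by assumption)] at hy hθ
    exact crtm_alg _ _ _ (hr y hy θ hθ)
  have I2 : ∀ t, (∫ θ in (0:ℝ)..π, mp θ * (np t θ / mp θ) ^ 2)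
      = ∫ θ in (0:ℝ)..π, np t θ ^ 2 * rp θ := by
    intro t
    apply intervalIntegral.integral_congr
    intro θ hθ
    rw [uIcc_of_le hπ0.le] at hθ
    exact crtm_alg _ _ _ (hrp θ hθ)
  have I3 : ∀ t, (∫ θ in (-π)..(0:ℝ), mm θ * (nm t θ / mm θ) ^ 2)
      = ∫ θ in (-π)..(0:ℝ), nm t θ ^ 2 * rm θ := by
    intro t
    apply intervalIntegral.integral_congr
    intro θ hθ
    rw [uIcc_of_le hπ1] at hθ
    exact crtm_alg _ _ _ (hrm θ hθ)
  simp only [I1, I2, I3]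
  have i1 : ∀ t, Continuous fun y => ∫ θ in (-π)..π, n t y θ ^ 2 * r y θ := fun t =>
    crtm_cont (fun y θ => n t y θ ^ 2 * r y θ) (by fun_prop) _ _
  constructor
  · have D1 : ∀ t, HasDerivAt (fun s => ∫ y in (-L)..L, ∫ θ in (-π)..π, n s y θ ^ 2 * r y θ)
        (∫ y in (-L)..L, ∫ θ in (-π)..π, 2 * (n t y θ * r y θ) * nt t y θ) t := by
      intro t
      refine crtm_param (fun s y => ∫ θ in (-π)..π, n s y θ ^ 2 * r y θ)
        (fun s y => ∫ θ in (-π)..π, 2 * (n s y θ * r y θ) * nt s y θ) ?_ ?_ ?_ _ _ t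
      · exact crtm_cont (fun (p : ℝ × ℝ) θ => n p.1 p.2 θ ^ 2 * r p.2 θ) (by fun_prop) _ _
      · exact crtm_cont (fun (p : ℝ × ℝ) θ => 2 * (n p.1 p.2 θ * r p.2 θ) * nt p.1 p.2 θ)
          (by fun_prop) _ _
      · intro t y
        refine crtm_param (fun s θ => n s y θ ^ 2 * r y θ)
          (fun s θ => 2 * (n s y θ * r y θ) * nt s y θ) (by fun_prop) (by fun_prop) ?_ _ _ t
        intro t θ
        exact (((dnt t y θ).pow 2).mul_const (r y θ)).congr_deriv (by simp; ring)
    have D2 : ∀ t, HasDerivAt (fun s => ∫ θ in (0:ℝ)..π, np s θ ^ 2 * rp θ)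
        (∫ θ in (0:ℝ)..π, 2 * (np t θ * rp θ) * npt t θ) t := by
      intro t
      refine crtm_param (fun s θ => np s θ ^ 2 * rp θ)
          (fun s θ => 2 * (np s θ * rp θ) * npt s θ) (by fun_prop) (by fun_prop) ?_ _ _ t
      intro t θ
      exact (((dnpt t θ).pow 2).mul_const (rp θ)).congr_deriv (by simp; ring)
    have D3 : ∀ t, HasDerivAt (fun s => ∫ θ in (-π)..(0:ℝ), nm s θ ^ 2 * rm θ)
        (∫ θ in (-π)..(0:ℝ), 2 * (nm t θ * rm θ) * nmt t θ) t := by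
      intro t
      refine crtm_param (fun s θ => nm s θ ^ 2 * rm θ)
          (fun s θ => 2 * (nm s θ * rm θ) * nmt s θ) (by fun_prop) (by fun_prop) ?_ _ _ t
      intro t θ
      exact (((dnmt t θ).pow 2).mul_const (rm θ)).congr_deriv (by simp; ring)
    have D := fun t => ((D1 t).add (D2 t)).add (D3 t)
    have anti := antitoneOn_of_deriv_nonpos (convex_Ici (0:ℝ))
      (fun t _ => (D t).continuousAt.continuousWithinAt)
      (fun t _ => (D t).differentiableAt.differentiableWithinAt) ?_
    · intro s t hs hst
      exact anti (mem_Ici.2 hs) (mem_Ici.2 (hs.trans hst)) hst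
    intro t ht
    rw [interior_Ici] at ht
    have ht0 : t ≥ 0 := le_of_lt ht
    rw [(D t).deriv]
    have hNM : ∀ y ∈ Icc (-L) L, ∀ θ ∈ Icc (-π) π, n t y θ = m y θ * (n t y θ * r y θ) := by
      intro y hy θ hθ
      linear_combination - n t y θ * hr y hy θ hθ
    have B := crtm_bulk V L hL K hKc hKnn (n t) (nt t) (ny t) m my (fun y θ => n t y θ * r y θ)
      (by fun_prop) (by fun_prop) (by fun_prop) cm cmy (by fun_prop) hm_pos hNM (dny t) dmy
      (by
        intro y hy θ hθ
        have := hsol.interior_eq t ht0 y hy θ hθ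
        rwa [(dnt t y θ).deriv, (dny t y θ).deriv] at this)
      (by
        intro y hy θ hθ
        have := hstat.interior_eq t ht0 y hy θ hθ
        simpa only [deriv_const, zero_add, (dmy y θ).deriv] using this)
    have mL : L ∈ Icc (-L) L := ⟨hLL, le_rfl⟩
    have mL' : -L ∈ Icc (-L) L := ⟨le_rfl, hLL⟩
    have sub1 : Icc 0 π ⊆ Icc (-π) π := Icc_subset_Icc_left hπ1
    have sub2 : Icc (-π) 0 ⊆ Icc (-π) π := Icc_subset_Icc_right hπ0.le
    have T := crtm_wall Kp hKpc hKpnn 0 π (-π) 0 hπ0.le hπ1 (fun θ => V * sin θ) (n t L) (m L)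
      (fun θ => n t L θ * r L θ) (np t) (npt t) mp (fun θ => np t θ * rp θ)
      (fun θ => ∫ x in (-π)..π, Kp θ (x - θ))
      (by fun_prop) (by fun_prop) (by fun_prop) (by fun_prop) (by fun_prop) (by fun_prop) cmp
      (by fun_prop)
      (fun x hx => mul_nonneg hV.le (sin_nonneg_of_nonneg_of_le_pi hx.1 hx.2))
      (fun x hx => (hm_pos L mL x (sub1 hx)).le)
      (fun x hx => (hmp_pos x hx).le)
      (fun x hx => hNM L mL x (sub1 hx)) (fun x hx => hNM L mL x (sub2 hx))
      (fun x hx => by linear_combination - np t x * hrp x hx)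
      (fun x => by
        rw [add_comm]
        exact (intervalIntegral.integral_add_adjacent_intervals
          (Continuous.intervalIntegrable (by fun_prop) _ _)
          (Continuous.intervalIntegrable (by fun_prop) _ _)).symm)
      (fun x hx => by
        have := hsol.top_eq t ht0 x hx
        rwa [(dnpt t x).deriv] at this)
      (fun x hx => by
        have := hstat.top_eq t ht0 x hx
        simpa only [deriv_const, zero_add] using this)
      (fun x hx => hsol.bc_top t ht0 x hx)
      (fun x hx => hstat.bc_top t ht0 x hx)
    have S := crtm_wall Km hKmc hKmnn (-π) 0 0 π hπ1 hπ0.le (fun θ => -(V * sin θ)) (n t (-L))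
      (m (-L))
      (fun θ => n t (-L) θ * r (-L) θ) (nm t) (nmt t) mm (fun θ => nm t θ * rm θ)
      (fun θ => ∫ x in (-π)..π, Km θ (x - θ))
      (by fun_prop) (by fun_prop) (by fun_prop) (by fun_prop) (by fun_prop) (by fun_prop) cmm
      (by fun_prop)
      (fun x hx => by
        have := mul_nonneg hV.le (neg_nonneg.2 (sin_nonpos_of_nonpos_of_neg_pi_le hx.2 hx.1))
        linarith)
      (fun x hx => (hm_pos (-L) mL' x (sub2 hx)).le)
      (fun x hx => (hmm_pos x hx).le)
      (fun x hx => hNM (-L) mL' x (sub2 hx)) (fun x hx => hNM (-L) mL' x (sub1 hx))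
      (fun x hx => by linear_combination - nm t x * hrm x hx)
      (fun x => 
        (intervalIntegral.integral_add_adjacent_intervals
          (Continuous.intervalIntegrable (by fun_prop) _ _)
          (Continuous.intervalIntegrable (by fun_prop) _ _)).symm)
      (fun x hx => by
        have := hsol.bot_eq t ht0 x hx
        rw [(dnmt t x).deriv] at this
        linarith)
      (fun x hx => by
        have := hstat.bot_eq t ht0 x hx
        simp only [deriv_const, zero_add] at this
        linarith)
      (fun x hx => by
        have := hsol.bc_bot t ht0 x hx
        linarith)
      (fun x hx => by
        have := hstat.bc_bot t ht0 x hx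
        linarith)
    simp only [neg_mul, intervalIntegral.integral_neg] at S
    have a1 := intervalIntegral.integral_add_adjacent_intervals (μ := volume) (a := -π) (b := 0)
      (c := π) (f := fun θ => V * sin θ * (m L θ * (n t L θ * r L θ) ^ 2))
      (Continuous.intervalIntegrable (by fun_prop) _ _)
      (Continuous.intervalIntegrable (by fun_prop) _ _)
    have a2 := intervalIntegral.integral_add_adjacent_intervals (μ := volume) (a := -π) (b := 0)
      (c := π) (f := fun θ => V * sin θ * (m (-L) θ * (n t (-L) θ * r (-L) θ) ^ 2))
      (Continuous.intervalIntegrable (by fun_prop) _ _)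
      (Continuous.intervalIntegrable (by fun_prop) _ _)
    linarith
  · intro Γ hΓ h1 h2 h3
    rw [mul_add, mul_add]
    simp only [← intervalIntegral.integral_const_mul]
    refine add_le_add (add_le_add ?_ ?_) ?_
    · apply intervalIntegral.integral_mono_on hLL ((i1 0).intervalIntegrable _ _)
        ((crtm_cont (fun y θ => Γ ^ 2 * m y θ) (by fun_prop) _ _).intervalIntegrable _ _)
      intro y hy
      apply intervalIntegral.integral_mono_on hπ
        (Continuous.intervalIntegrable (by fun_prop) _ _)
        (Continuous.intervalIntegrable (by fun_prop) _ _)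
      intro θ hθ
      exact crtm_bd _ _ _ _ (hm_pos y hy θ hθ) (hn_nn 0 le_rfl y hy θ hθ) (hr y hy θ hθ)
        (h1 y hy θ hθ)
    · apply intervalIntegral.integral_mono_on hπ0.le
        (Continuous.intervalIntegrable (by fun_prop) _ _)
        (Continuous.intervalIntegrable (by fun_prop) _ _)
      intro θ hθ
      exact crtm_bd _ _ _ _ (hmp_pos θ hθ) (hnp_nn 0 le_rfl θ hθ) (hrp θ hθ) (h2 θ hθ)
    · apply intervalIntegral.integral_mono_on hπ1
        (Continuous.intervalIntegrable (by fun_prop) _ _)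
        (Continuous.intervalIntegrable (by fun_prop) _ _)
      intro θ hθ
      exact crtm_bd _ _ _ _ (hmm_pos θ hθ) (hnm_nn 0 le_rfl θ hθ) (hrm θ hθ) (h3 θ hθ)
end
end

section
/- Discrete mass conservation of the semi-discretized scheme. Let N_y, N_θ be positive integers, Δy = L/N_y, Δθ = π/N_θ, V > 0, ε > 0, and θ_j = (j − N_θ − 1/2)Δθ for j ∈ I_θ, where I_y = {1,…,2N_y}, I_{θ+} = {N_θ+1,…,2N_θ}, I_{θ−} = {1,…,N_θ}, I_θ = I_{θ−} ∪ I_{θ+}. Let K_{i,j,j'} ≥ 0 (i ∈ I_y, j,j' ∈ I_θ), K_{+,j,j'} ≥ 0 (j ∈ I_{θ+}, j' ∈ I_θ), K_{−,j,j'} ≥ 0 (j ∈ I_{θ−}, j' ∈ I_θ) be given coefficients, and set k_{i,j} = (1/ε)∑_{j'∈I_θ} K_{i,j,j'}, k_{+,j} = (1/ε)∑_{j'∈I_θ} K_{+,j,j'}, k_{−,j} = (1/ε)∑_{j'∈I_θ} K_{−,j,j'}. Let differentiable functions n_{i,j}(t) (i ∈ I_y, j ∈ I_θ), n_{+,j}(t)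 (j ∈ I_{θ+}), n_{−,j}(t) (j ∈ I_{θ−}) satisfy the semi-discrete scheme: for j ∈ I_{θ+}: n_{i,j}' + V sin θ_j (n_{i,j} − n_{i−1,j})/Δy + (1/ε²)(k_{i,j} n_{i,j} − (1/ε)∑_{j'∈I_θ} K_{i,j',j} n_{i,j'}) = 0 for all i ∈ I_y, where the ghost value n_{0,j} is defined by V sin θ_j n_{0,j} = (1/ε³)∑_{j'∈I_{θ−}} K_{−,j',j} n_{−,j'}; for j ∈ I_{θ−}: n_{i,j}' + V sin θ_j (n_{i+1,j} − n_{i,j})/Δy + (1/ε²)(k_{i,j} n_{i,j} − (1/ε)∑_{j'∈I_θ} K_{i,j',j} n_{i,j'}) = 0 for all i ∈ I_y, where the ghost value n_{2N_y+1,j} is defined by −V sin θ_j n_{2N_y+1,j} = (1/ε³)∑_{j'∈I_{θ+}} K_{+,j',j} n_{+,j'}; for j ∈ I_{θ+}: n_{+,j}' + (1/ε²)(k_{+,j} n_{+,j} − (1/ε)∑_{j'∈I_{θ+}} K_{+,j',j} n_{+,j'}) = V sin θ_j n_{2N_y,j}; for j ∈ I_{θ−}: n_{−,j}' + (1/ε²)(k_{−,j}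 n_{−,j} − (1/ε)∑_{j'∈I_{θ−}} K_{−,j',j} n_{−,j'}) = −V sin θ_j n_{1,j}. Then the discrete total mass M_h(t) = ΔyΔθ ∑_{i∈I_y}∑_{j∈I_θ} n_{i,j}(t) + Δθ ∑_{j∈I_{θ+}} n_{+,j}(t) + Δθ ∑_{j∈I_{θ−}} n_{−,j}(t) satisfies d M_h/dt = 0, i.e. M_h is constant in time. -/
open Real Finset

noncomputable section

/-- The angular grid point `θ_j = (j − N_θ − 1/2) Δθ` with `Δθ = π / N_θ`. -/
def thetaGrid (Nθ : ℕ) (j : ℕ) : ℝ := ((j : ℝ) - (Nθ : ℝ) - 1 / 2) * (π / (Nθ : ℝ))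

theorem aux_tele1 (f : ℕ → ℝ) (N : ℕ) :
    ∑ i ∈ Icc 1 N, (f i - f (i - 1)) = f N - f 0 := by
  induction N with
  | zero => simp
  | succ k ih => rw [Finset.sum_Icc_succ_top (by omega), ih]; simp

theorem aux_tele2 (f : ℕ → ℝ) (N : ℕ) :
    ∑ i ∈ Icc 1 N, (f (i + 1) - f i) = f (N + 1) - f 1 := by
  induction N with
  | zero => simp
  | succ k ih => rw [Finset.sum_Icc_succ_top (by omega), ih]; ring

theorem aux_split (f : ℕ → ℝ) (N : ℕ) :
    ∑ i ∈ Icc 1 (2 * N), f i = ∑ i ∈ Icc 1 N, f i + ∑ i ∈ Icc (N + 1) (2 * N), f i := by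
  rw [← Finset.sum_union]
  · congr 1
    ext x
    simp only [Finset.mem_union, Finset.mem_Icc]
    omega
  · rw [Finset.disjoint_left]
    intro x
    simp only [Finset.mem_Icc]
    omega

theorem aux_swap (A B : Finset ℕ) (K : ℕ → ℕ → ℝ) (f : ℕ → ℝ) :
    ∑ j ∈ A, (∑ j' ∈ B, K j j') * f j = ∑ j ∈ B, ∑ j' ∈ A, K j' j * f j' := by
  rw [Finset.sum_comm]
  exact Finset.sum_congr rfl fun j _ => Finset.sum_mul _ _ _

/-- **Discrete mass conservation of the semi-discretized scheme.**  For the upwind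
semi-discretization of the scaled CRTM, with discrete total rates equal to the row sums
of the discrete kernels and ghost values given by the discrete inflow boundary
conditions, the discrete total mass
`M_h(t) = ΔyΔθ ∑_{i∈I_y}∑_{j∈I_θ} n_{i,j}(t) + Δθ ∑_{j∈I_{θ+}} n_{+,j}(t)
  + Δθ ∑_{j∈I_{θ−}} n_{−,j}(t)` is constant in time. -/
theorem discrete_mass_conservation
    (L V ε : ℝ) (hL : 0 < L) (hV : 0 < V) (hε : 0 < ε)
    (Ny Nθ : ℕ) (hNy : 0 < Ny) (hNθ : 0 < Nθ)
    (Ki : ℕ → ℕ → ℕ → ℝ) (Kp : ℕ → ℕ → ℝ) (Km : ℕ → ℕ → ℝ)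
    (hKi_nn : ∀ i ∈ Icc 1 (2 * Ny), ∀ j ∈ Icc 1 (2 * Nθ), ∀ j' ∈ Icc 1 (2 * Nθ),
      0 ≤ Ki i j j')
    (hKp_nn : ∀ j ∈ Icc (Nθ + 1) (2 * Nθ), ∀ j' ∈ Icc 1 (2 * Nθ), 0 ≤ Kp j j')
    (hKm_nn : ∀ j ∈ Icc 1 Nθ, ∀ j' ∈ Icc 1 (2 * Nθ), 0 ≤ Km j j')
    (n : ℝ → ℕ → ℕ → ℝ) (np : ℝ → ℕ → ℝ) (nm : ℝ → ℕ → ℝ)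
    (hdiff : ∀ i j, Differentiable ℝ (fun t => n t i j))
    (hdiffp : ∀ j, Differentiable ℝ (fun t => np t j))
    (hdiffm : ∀ j, Differentiable ℝ (fun t => nm t j))
    -- interior scheme, upward-moving directions (j ∈ I_{θ+}), upwind from below
    (hschemeP : ∀ t : ℝ, ∀ j ∈ Icc (Nθ + 1) (2 * Nθ), ∀ i ∈ Icc 1 (2 * Ny),
      deriv (fun s => n s i j) t
        + V * sin (thetaGrid Nθ j) * (n t i j - n t (i - 1) j) / (L / (Ny : ℝ))
        + (1 / ε ^ 2) * ((1 / ε) * (∑ j' ∈ Icc 1 (2 * Nθ), Ki i j j') * n t i j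
            - (1 / ε) * ∑ j' ∈ Icc 1 (2 * Nθ), Ki i j' j * n t i j') = 0)
    -- interior scheme, downward-moving directions (j ∈ I_{θ−}), upwind from above
    (hschemeM : ∀ t : ℝ, ∀ j ∈ Icc 1 Nθ, ∀ i ∈ Icc 1 (2 * Ny),
      deriv (fun s => n s i j) t
        + V * sin (thetaGrid Nθ j) * (n t (i + 1) j - n t i j) / (L / (Ny : ℝ))
        + (1 / ε ^ 2) * ((1 / ε) * (∑ j' ∈ Icc 1 (2 * Nθ), Ki i j j') * n t i j
            - (1 / ε) * ∑ j' ∈ Icc 1 (2 * Nθ), Ki i j' j * n t i j') = 0)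
    -- ghost value at the bottom wall (inflow for j ∈ I_{θ+})
    (hghost_bot : ∀ t : ℝ, ∀ j ∈ Icc (Nθ + 1) (2 * Nθ),
      V * sin (thetaGrid Nθ j) * n t 0 j
        = (1 / ε ^ 3) * ∑ j' ∈ Icc 1 Nθ, Km j' j * nm t j')
    -- ghost value at the top wall (inflow for j ∈ I_{θ−})
    (hghost_top : ∀ t : ℝ, ∀ j ∈ Icc 1 Nθ,
      -(V * sin (thetaGrid Nθ j) * n t (2 * Ny + 1) j)
        = (1 / ε ^ 3) * ∑ j' ∈ Icc (Nθ + 1) (2 * Nθ), Kp j' j * np t j')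
    -- upper-boundary scheme
    (hbdryP : ∀ t : ℝ, ∀ j ∈ Icc (Nθ + 1) (2 * Nθ),
      deriv (fun s => np s j) t
        + (1 / ε ^ 2) * ((1 / ε) * (∑ j' ∈ Icc 1 (2 * Nθ), Kp j j') * np t j
            - (1 / ε) * ∑ j' ∈ Icc (Nθ + 1) (2 * Nθ), Kp j' j * np t j')
        = V * sin (thetaGrid Nθ j) * n t (2 * Ny) j)
    -- lower-boundary scheme
    (hbdryM : ∀ t : ℝ, ∀ j ∈ Icc 1 Nθ,
      deriv (fun s => nm s j) t
        + (1 / ε ^ 2) * ((1 / ε) * (∑ j' ∈ Icc 1 (2 * Nθ), Km j j') * nm t j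
            - (1 / ε) * ∑ j' ∈ Icc 1 Nθ, Km j' j * nm t j')
        = -(V * sin (thetaGrid Nθ j) * n t 1 j)) :
    ∀ t : ℝ,
      (L / (Ny : ℝ)) * (π / (Nθ : ℝ))
          * (∑ i ∈ Icc 1 (2 * Ny), ∑ j ∈ Icc 1 (2 * Nθ), n t i j)
        + (π / (Nθ : ℝ)) * (∑ j ∈ Icc (Nθ + 1) (2 * Nθ), np t j)
        + (π / (Nθ : ℝ)) * (∑ j ∈ Icc 1 Nθ, nm t j)
      = (L / (Ny : ℝ)) * (π / (Nθ : ℝ))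
          * (∑ i ∈ Icc 1 (2 * Ny), ∑ j ∈ Icc 1 (2 * Nθ), n 0 i j)
        + (π / (Nθ : ℝ)) * (∑ j ∈ Icc (Nθ + 1) (2 * Nθ), np 0 j)
        + (π / (Nθ : ℝ)) * (∑ j ∈ Icc 1 Nθ, nm 0 j) := by
  have hΔ : (L / (Ny : ℝ)) ≠ 0 := by positivity
  set Δ := L / (Ny : ℝ) with hΔdef
  set P := Icc (Nθ + 1) (2 * Nθ) with hP
  set M := Icc 1 Nθ with hM
  have hzero : ∀ t : ℝ,
      Δ * (∑ i ∈ Icc 1 (2 * Ny), ∑ j ∈ Icc 1 (2 * Nθ), deriv (fun s => n s i j) t)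
        + (∑ j ∈ P, deriv (fun s => np s j) t) + (∑ j ∈ M, deriv (fun s => nm s j) t) = 0 := by
    intro t
    set C : ℕ → ℕ → ℝ := fun i j => (1 / ε ^ 2) *
      ((1 / ε) * (∑ j' ∈ Icc 1 (2 * Nθ), Ki i j j') * n t i j
            - (1 / ε) * ∑ j' ∈ Icc 1 (2 * Nθ), Ki i j' j * n t i j') with hC
    have hC0 : ∀ i, ∑ j ∈ Icc 1 (2 * Nθ), C i j = 0 := by
      intro i
      have := aux_swap (Icc 1 (2 * Nθ)) (Icc 1 (2 * Nθ)) (Ki i) (n t i)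
      simp only [hC, mul_assoc]
      rw [← Finset.mul_sum, Finset.sum_sub_distrib, ← Finset.mul_sum, ← Finset.mul_sum, this]
      ring
    have hCC : ∑ j ∈ M, ∑ i ∈ Icc 1 (2 * Ny), C i j + ∑ j ∈ P, ∑ i ∈ Icc 1 (2 * Ny), C i j = 0 := by
      rw [← aux_split (fun j => ∑ i ∈ Icc 1 (2 * Ny), C i j) Nθ, Finset.sum_comm]
      exact Finset.sum_eq_zero fun i _ => hC0 i
    have h1 : ∀ j ∈ P, Δ * ∑ i ∈ Icc 1 (2 * Ny), deriv (fun s => n s i j) t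
        = -(V * sin (thetaGrid Nθ j) * n t (2 * Ny) j)
          + (1 / ε ^ 3) * (∑ j' ∈ M, Km j' j * nm t j')
          - Δ * ∑ i ∈ Icc 1 (2 * Ny), C i j := by
      intro j hj
      rw [← hghost_bot t j hj]
      have e : -(V * sin (thetaGrid Nθ j) * n t (2 * Ny) j) + V * sin (thetaGrid Nθ j) * n t 0 j
          = -(V * sin (thetaGrid Nθ j)) *
            ∑ i ∈ Icc 1 (2 * Ny), (n t i j - n t (i - 1) j) := by
        rw [aux_tele1 (fun i => n t i j)]; ring
      rw [e, Finset.mul_sum, Finset.mul_sum, Finset.mul_sum, ← Finset.sum_sub_distrib]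
      refine Finset.sum_congr rfl fun i hi => ?_
      have h := hschemeP t j hj i hi
      change _ + _ + C i j = 0 at h
      field_simp at h
      linarith
    have h2 : ∀ j ∈ M, Δ * ∑ i ∈ Icc 1 (2 * Ny), deriv (fun s => n s i j) t
        = V * sin (thetaGrid Nθ j) * n t 1 j
          + (1 / ε ^ 3) * (∑ j' ∈ P, Kp j' j * np t j')
          - Δ * ∑ i ∈ Icc 1 (2 * Ny), C i j := by
      intro j hj
      rw [← hghost_top t j hj]
      have e : V * sin (thetaGrid Nθ j) * n t 1 j + -(V * sin (thetaGrid Nθ j) * n t (2 * Ny + 1) j)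
          = -(V * sin (thetaGrid Nθ j)) *
            ∑ i ∈ Icc 1 (2 * Ny), (n t (i + 1) j - n t i j) := by
        rw [aux_tele2 (fun i => n t i j)]; ring
      rw [e, Finset.mul_sum, Finset.mul_sum, Finset.mul_sum, ← Finset.sum_sub_distrib]
      refine Finset.sum_congr rfl fun i hi => ?_
      have h := hschemeM t j hj i hi
      change _ + _ + C i j = 0 at h
      field_simp at h
      linarith
    have h3 : ∀ j ∈ P, deriv (fun s => np s j) t = V * sin (thetaGrid Nθ j) * n t (2 * Ny) j
        - (1 / ε ^ 3) * ((∑ j' ∈ Icc 1 (2 * Nθ), Kp j j') * np t j)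
        + (1 / ε ^ 3) * ∑ j' ∈ P, Kp j' j * np t j' := by
      intro j hj
      rw [← hbdryP t j hj]
      field_simp
      ring
    have h4 : ∀ j ∈ M, deriv (fun s => nm s j) t = -(V * sin (thetaGrid Nθ j) * n t 1 j)
        - (1 / ε ^ 3) * ((∑ j' ∈ Icc 1 (2 * Nθ), Km j j') * nm t j)
        + (1 / ε ^ 3) * ∑ j' ∈ M, Km j' j * nm t j' := by
      intro j hj
      rw [← hbdryM t j hj]
      field_simp
      ring
    rw [Finset.sum_comm, Finset.mul_sum, aux_split, ← hM, ← hP, Finset.sum_congr rfl h1,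
      Finset.sum_congr rfl h2, Finset.sum_congr rfl h3, Finset.sum_congr rfl h4]
    simp only [Finset.sum_add_distrib, Finset.sum_sub_distrib, ← Finset.mul_sum,
      Finset.sum_neg_distrib]
    rw [aux_swap, aux_swap, aux_split, aux_split, ← hM, ← hP]
    linear_combination (-Δ) * hCC
  intro t
  set c := π / (Nθ : ℝ)
  have hd : ∀ s : ℝ, HasDerivAt (fun t => Δ * c * (∑ i ∈ Icc 1 (2 * Ny), ∑ j ∈ Icc 1 (2 * Nθ), n t i j)
        + c * (∑ j ∈ P, np t j) + c * (∑ j ∈ M, nm t j)) 0 s := by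
    intro s
    have ha : HasDerivAt (fun t => ∑ i ∈ Icc 1 (2 * Ny), ∑ j ∈ Icc 1 (2 * Nθ), n t i j)
        (∑ i ∈ Icc 1 (2 * Ny), ∑ j ∈ Icc 1 (2 * Nθ), deriv (fun s => n s i j) s) s :=
      HasDerivAt.fun_sum fun i _ => HasDerivAt.fun_sum fun j _ => (hdiff i j s).hasDerivAt
    have hb : HasDerivAt (fun t => ∑ j ∈ P, np t j) (∑ j ∈ P, deriv (fun s => np s j) s) s :=
      HasDerivAt.fun_sum fun j _ => (hdiffp j s).hasDerivAt
    have hc : HasDerivAt (fun t => ∑ j ∈ M, nm t j) (∑ j ∈ M, deriv (fun s => nm s j) s) s :=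
      HasDerivAt.fun_sum fun j _ => (hdiffm j s).hasDerivAt
    have hall := ((ha.const_mul (Δ * c)).fun_add (hb.const_mul c)).fun_add (hc.const_mul c)
    refine hall.congr_deriv ?_
    linear_combination c * hzero s
  exact is_const_of_deriv_eq_zero (fun s => (hd s).differentiableAt) (fun s => (hd s).deriv) t 0
end
end
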